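/- Let X and Y be Jordan curves in ℝ², with interiors B_X and B_Y. If f : closure(B_X) → ℝ² is continuous, its restriction to B_X is a bounded local homeomorphism, and f(X) ⊆ Y, then f restricts to a global homeomorphism from B_X onto B_Y. -/

import Mathlib

open Set

/-- A Jordan curve in the plane: a homeomorphic image of the circle. -/
def IsJordanCurve (X : Set (ℝ × ℝ)) : Prop :=
  ∃ γ : Circle → ℝ × ℝ, Continuous γ ∧ Function.Injective γ ∧ Set.range γ = X

/-- `B` is the interior (the bounded connected component of the complement)
of the Jordan curve `X`. -/
def IsJordanInterior (X B : Set (ℝ × ℝ)) : Prop :=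
  Bornology.IsBounded B ∧ ∃ x ∈ Xᶜ, B = connectedComponentIn Xᶜ x

/-- The identification of the plane with the complex numbers. -/
def planeToComplex (p : ℝ × ℝ) : ℂ := ⟨p.1, p.2⟩

lemma continuous_planeToComplex : Continuous planeToComplex :=
  Complex.equivRealProdCLM.symm.continuous

lemma planeToComplex_injective : Function.Injective planeToComplex :=
  Complex.equivRealProdCLM.symm.injective

lemma planeToComplex_sub_ne_zero {p q : ℝ × ℝ} (h : p ≠ q) :
    planeToComplex p - planeToComplex q ≠ 0 :=
  sub_ne_zero.2 (planeToComplex_injective.ne h)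

/-- A continuous function all of whose values are logarithms of `1` is constant on
preconnected sets. -/
lemma eq_of_exp_eq_one {A : Type*} [TopologicalSpace A] {S : Set A} (hS : IsPreconnected S)
    {w : A → ℂ} (hw : ContinuousOn w S) (h : ∀ x ∈ S, Complex.exp (w x) = 1)
    {x y : A} (hx : x ∈ S) (hy : y ∈ S) : w x = w y := by
  have : DiscreteTopology (AddSubgroup.zmultiples (2 * Real.pi * Complex.I)) :=
    NormedSpace.discreteTopology_zmultiples _
  refine hS.constant_of_mapsTo
    (T := (AddSubgroup.zmultiples (2 * Real.pi * Complex.I) : Set ℂ)) ⟨this⟩ hw (fun z hz ↦ ?_) hx hy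
  obtain ⟨n, hn⟩ := Complex.exp_eq_one_iff.1 (h z hz)
  exact AddSubgroup.mem_zmultiples_iff.2 ⟨n, by rw [hn]; simp⟩

/-- A nowhere vanishing continuous function on a simply connected, locally path connected space
has a continuous logarithm. -/
lemma exists_continuous_log {A : Type*} [TopologicalSpace A] [SimplyConnectedSpace A]
    [LocallyPathConnectedSpace A] {F : A → ℂ} (hF : Continuous F) (h0 : ∀ x, F x ≠ 0) :
    ∃ L : A → ℂ, Continuous L ∧ ∀ x, Complex.exp (L x) = F x := by
  obtain ⟨a₀⟩ : Nonempty A := inferInstance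
  obtain ⟨L, ⟨-, hL⟩, -⟩ := Complex.isCoveringMapOn_exp.existsUnique_continuousMap_lifts
    ⟨F, hF⟩ (a₀ := a₀) (e₀ := Complex.log (F a₀)) (Complex.exp_log (h0 a₀)) (fun a ↦ h0 a)
  exact ⟨L, L.continuous, fun x ↦ congrFun hL x⟩

/-- Borsuk's separation criterion: on the boundary of a bounded open set `W`, a monomial in
`z - a` and `z - b`, where `a ∈ W` and `b ∉ closure W`, has a continuous logarithm only if the
exponent of `z - a` vanishes. -/
lemma exponent_eq_zero_of_log_on_frontier {W : Set (ℝ × ℝ)} (hW : Bornology.IsBounded W)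
    {a b : ℝ × ℝ} (ha : a ∈ interior W) (hb : b ∉ closure W) {m n : ℤ} {g : ℝ × ℝ → ℂ}
    (hg : ContinuousOn g (frontier W))
    (hexp : ∀ z ∈ frontier W, Complex.exp (g z) =
      (planeToComplex z - planeToComplex a) ^ m * (planeToComplex z - planeToComplex b) ^ n) :
    m = 0 := by
  classical
  obtain ⟨G, hG⟩ := ContinuousMap.exists_restrict_eq (isClosed_frontier (s := W))
    ⟨(frontier W).domRestrict g, hg.domRestrict⟩
  have hG' : ∀ z ∈ frontier W, G z = g z := fun z hz ↦ congrArg (fun k ↦ k ⟨z, hz⟩) hG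
  have hcl : ∀ z ∈ closure W, planeToComplex z - planeToComplex b ≠ 0 := fun z hz ↦
    planeToComplex_sub_ne_zero fun h ↦ hb (h ▸ hz)
  have hco : ∀ z ∈ closure Wᶜ, planeToComplex z - planeToComplex a ≠ 0 := fun z hz ↦
    planeToComplex_sub_ne_zero fun h ↦ by
      rw [closure_compl] at hz
      exact hz (h ▸ ha)
  have hc := continuous_planeToComplex
  let F : ℝ × ℝ → ℂ := W.piecewise
    (fun z ↦ Complex.exp (G z) * (planeToComplex z - planeToComplex b) ^ (-n))
    (fun z ↦ (planeToComplex z - planeToComplex a) ^ m)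
  have hF : Continuous F := by
    rw [← continuousOn_univ]
    refine ContinuousOn.piecewise ?_ ?_ ?_
    · rintro z ⟨-, hz⟩
      rw [hG' z hz, hexp z hz, mul_assoc, ← zpow_add₀ (hcl z hz.1)]
      simp
    · rw [univ_inter]
      exact (by fun_prop : ContinuousOn (fun z ↦ Complex.exp (G z)) _).mul
        (ContinuousOn.zpow₀ (by fun_prop) _ fun z hz ↦ Or.inl (hcl z hz))
    · rw [univ_inter]
      exact ContinuousOn.zpow₀ (by fun_prop) _ fun z hz ↦ Or.inl (hco z hz)
  have hF0 : ∀ z, F z ≠ 0 := by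
    intro z
    by_cases hz : z ∈ W
    · simp only [F, piecewise_eq_of_mem _ _ _ hz]
      exact mul_ne_zero (Complex.exp_ne_zero _) (zpow_ne_zero _ (hcl z (subset_closure hz)))
    · simp only [F, piecewise_eq_of_notMem _ _ _ hz]
      exact zpow_ne_zero _ (hco z (subset_closure hz))
  obtain ⟨L, hL, hLF⟩ := exists_continuous_log hF hF0
  obtain ⟨R, hR⟩ := hW.subset_closedBall a
  have hR0 : 0 ≤ R := by
    have := hR (interior_subset ha)
    simpa using this
  let r : ℝ := 2 * R + 1
  have hr : 0 < r := by positivity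
  let circ : ℝ → ℝ × ℝ := fun t ↦ (a.1 + r * Real.cos t, a.2 + r * Real.sin t)
  have hcirc : Continuous circ := by fun_prop
  have hcW : ∀ t, circ t ∉ W := by
    intro t ht
    have h1 := hR ht
    rw [Metric.mem_closedBall, Prod.dist_eq, max_le_iff, Real.dist_eq, Real.dist_eq] at h1
    simp only [circ, add_sub_cancel_left] at h1
    have h2 := sq_le_sq' (abs_le.1 h1.1).1 (abs_le.1 h1.1).2
    have h3 := sq_le_sq' (abs_le.1 h1.2).1 (abs_le.1 h1.2).2
    have h4 := Real.sin_sq_add_cos_sq t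
    have h5 : r ^ 2 ≤ 2 * R ^ 2 := by
      calc r ^ 2 = (r * Real.cos t) ^ 2 + (r * Real.sin t) ^ 2 := by
            linear_combination (-r ^ 2) * h4
        _ ≤ _ := by linarith
    simp only [r] at h5
    nlinarith
  have hval : ∀ t : ℝ, Complex.exp (L (circ t) - m * (t * Complex.I) - m * Real.log r) = 1 := by
    intro t
    have h1 : planeToComplex (circ t) - planeToComplex a =
        Complex.exp (Real.log r + t * Complex.I) := by
      rw [Complex.exp_add, ← Complex.ofReal_exp, Real.exp_log hr, Complex.exp_mul_I]
      apply Complex.ext <;>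
        simp [planeToComplex, circ, ← Complex.ofReal_cos, ← Complex.ofReal_sin]
    rw [sub_sub, ← mul_add, Complex.exp_sub, hLF]
    simp only [F, piecewise_eq_of_notMem _ _ _ (hcW t)]
    rw [h1, ← Complex.exp_int_mul, add_comm, div_self (Complex.exp_ne_zero _)]
  have hconst := eq_of_exp_eq_one isPreconnected_univ
    (w := fun t : ℝ ↦ L (circ t) - m * (t * Complex.I) - m * Real.log r)
    (by fun_prop) (fun t _ ↦ hval t) (mem_univ 0) (mem_univ (2 * Real.pi))
  have hper : circ (2 * Real.pi) = circ 0 := by simp [circ]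
  simp only [hper] at hconst
  have h2 : (m : ℂ) * ((2 * Real.pi : ℝ) * Complex.I) = 0 := by
    have : ((0 : ℝ) : ℂ) = 0 := by simp
    rw [this] at hconst
    linear_combination hconst
  simpa [Real.pi_ne_zero] using h2

/-- The inverse of an injective continuous map on a compact space is continuous on the range. -/
lemma continuousOn_invFun_range {A B : Type*} [TopologicalSpace A] [CompactSpace A] [Nonempty A]
    [TopologicalSpace B] [T2Space B] {γ : A → B} (hc : Continuous γ)
    (hi : Function.Injective γ) : ContinuousOn (Function.invFun γ) (range γ) := by
  rw [continuousOn_iff_continuous_domRestrict]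
  let e := (hc.isClosedEmbedding hi).isEmbedding.toHomeomorph
  convert e.symm.continuous using 1
  funext ⟨_, x, rfl⟩
  have : e x = ⟨γ x, x, rfl⟩ := rfl
  rw [← this, e.symm_apply_apply, this]
  exact Function.leftInverse_invFun hi x

lemma IsJordanCurve.isCompact {Y : Set (ℝ × ℝ)} (hY : IsJordanCurve Y) : IsCompact Y := by
  obtain ⟨γ, hc, -, rfl⟩ := hY
  exact isCompact_range hc

lemma IsJordanCurve.isPreconnected {Y : Set (ℝ × ℝ)} (hY : IsJordanCurve Y) :
    IsPreconnected Y := by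
  obtain ⟨γ, hc, -, rfl⟩ := hY
  have : Circle.exp '' univ = univ := by
    rw [image_univ]
    exact range_eq_univ.2 fun z ↦ ⟨_, Circle.exp_arg z⟩
  have h2 : IsPreconnected (univ : Set Circle) := by
    rw [← this]; exact isPreconnected_univ.image _ Circle.exp.continuous.continuousOn
  rw [← image_univ]
  exact h2.image _ hc.continuousOn

lemma exists_notMem_of_isBounded {W : Set (ℝ × ℝ)} (hW : Bornology.IsBounded W) :
    ∃ b, b ∉ closure W := by
  by_contra! h
  have : closure W = univ := eq_univ_of_forall h
  exact NormedSpace.unbounded_univ ℝ (ℝ × ℝ) (this ▸ hW.closure)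

/-- A nonvanishing continuous function on a convex set has a continuous logarithm. -/
lemma Convex.exists_continuousOn_log {E : Type*} [NormedAddCommGroup E] [NormedSpace ℝ E]
    {S : Set E} (hS : Convex ℝ S) (hne : S.Nonempty) {F : E → ℂ} (hF : ContinuousOn F S)
    (h0 : ∀ x ∈ S, F x ≠ 0) :
    ∃ L : E → ℂ, ContinuousOn L S ∧ ∀ x ∈ S, Complex.exp (L x) = F x := by
  classical
  have := hS.contractibleSpace hne
  have := hS.locallyPathConnectedSpace
  obtain ⟨L, hL, hLF⟩ := exists_continuous_log hF.domRestrict fun x : S ↦ h0 x x.2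
  refine ⟨fun x ↦ if h : x ∈ S then L ⟨x, h⟩ else 0, ?_, fun x hx ↦ ?_⟩
  · rw [continuousOn_iff_continuous_domRestrict]
    convert hL using 1
    funext x
    simp
  · simpa [hx] using hLF ⟨x, hx⟩

/-- A bounded open set whose boundary lies on a Jordan curve does not meet the curve. -/
lemma IsJordanCurve.disjoint_of_frontier_subset {Y : Set (ℝ × ℝ)} (hY : IsJordanCurve Y)
    {V : Set (ℝ × ℝ)} (hV : IsOpen V) (hb : Bornology.IsBounded V) (hfr : frontier V ⊆ Y) :
    Disjoint V Y := by
  rw [Set.disjoint_left]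
  intro y hyV hyY
  obtain ⟨γ, hc, hi, rfl⟩ := hY
  obtain ⟨w₀, rfl⟩ := hyY
  let v₀ : Circle := w₀ * (Circle.exp Real.pi)⁻¹
  obtain ⟨h, hh, hexp⟩ := (convex_Ioo (-Real.pi) Real.pi).exists_continuousOn_log
    ⟨0, by simp [Real.pi_pos]⟩
    (F := fun t ↦ planeToComplex (γ (v₀ * Circle.exp t)) - planeToComplex (γ w₀))
    (Continuous.continuousOn <|
      (continuous_planeToComplex.comp (hc.comp (by fun_prop))).sub continuous_const)
    (fun t ht ↦ planeToComplex_sub_ne_zero fun heq ↦ by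
      have h1 : v₀ * Circle.exp t = w₀ := hi heq
      have h3 : Circle.exp t = Circle.exp Real.pi := by
        rw [← mul_right_inj v₀, h1, inv_mul_cancel_right]
      have h4 := Circle.arg_exp ht.1 ht.2.le
      rw [h3, Circle.arg_exp (by linarith [Real.pi_pos]) le_rfl] at h4
      exact ht.2.ne' h4)
  let u : ℝ × ℝ → Circle := fun z ↦ v₀⁻¹ * Function.invFun γ z
  have hu : ContinuousOn u (range γ) := continuousOn_const.mul (continuousOn_invFun_range hc hi)
  have huγ : ∀ w, u (γ w) = v₀⁻¹ * w := fun w ↦ by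
    simp only [u, Function.leftInverse_invFun hi w]
  have hslit : ∀ z ∈ frontier V, Complex.arg (u z) ≠ Real.pi ∧ γ (v₀ * u z) = z := by
    intro z hz
    obtain ⟨w, rfl⟩ := hfr hz
    have h1 : v₀ * u (γ w) = w := by rw [huγ, mul_inv_cancel_left]
    refine ⟨fun h2 ↦ ?_, by rw [h1]⟩
    rw [← Circle.exp_arg (u (γ w)), h2, inv_mul_cancel_right] at h1
    rw [hV.frontier_eq, ← h1] at hz
    exact hz.2 hyV
  have := exponent_eq_zero_of_log_on_frontier (a := γ w₀) hb (m := 1) (n := 0)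
    (g := fun z ↦ h (Complex.arg (u z))) (by rwa [hV.interior_eq])
    (exists_notMem_of_isBounded hb).choose_spec ?_ ?_
  · exact one_ne_zero this
  · refine hh.comp (fun z hz ↦ ?_) fun z hz ↦
      ⟨Complex.neg_pi_lt_arg _, (Complex.arg_le_pi _).lt_of_ne (hslit z hz).1⟩
    have h0 : Continuous (fun w : Circle ↦ (w : ℂ)) := continuous_induced_dom
    have h1 : ContinuousAt (fun w : Circle ↦ Complex.arg w) (u z) :=
      ContinuousAt.comp (f := fun w : Circle ↦ (w : ℂ)) (Complex.continuousAt_arg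
        (Complex.mem_slitPlane_iff_arg.2 ⟨(hslit z hz).1, Circle.coe_ne_zero _⟩)) h0.continuousAt
    exact h1.comp_continuousWithinAt ((hu z (hfr hz)).mono hfr)
  · intro z hz
    rw [hexp _ ⟨Complex.neg_pi_lt_arg _, (Complex.arg_le_pi _).lt_of_ne (hslit z hz).1⟩,
      Circle.exp_arg, (hslit z hz).2]
    simp

/-- Two bounded open sets whose boundaries lie on the same Jordan curve meet. -/
lemma IsJordanCurve.not_disjoint_of_frontier_subset {Y : Set (ℝ × ℝ)} (hY : IsJordanCurve Y)
    {V W : Set (ℝ × ℝ)} (hV : IsOpen V) (hVb : Bornology.IsBounded V) (hVn : V.Nonempty)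
    (hVfr : frontier V ⊆ Y) (hW : IsOpen W) (hWb : Bornology.IsBounded W) (hWn : W.Nonempty)
    (hWfr : frontier W ⊆ Y) : ¬ Disjoint V W := by
  intro hVW
  have hVY := hY.disjoint_of_frontier_subset hV hVb hVfr
  have hWY := hY.disjoint_of_frontier_subset hW hWb hWfr
  obtain ⟨γ, hc, hi, rfl⟩ := hY
  obtain ⟨a, ha⟩ := hVn
  obtain ⟨b, hb⟩ := hWn
  have hlog : ∀ p ∉ range γ, ∃ h : ℝ → ℂ, ∃ d : ℤ, Continuous h ∧
      (∀ t, Complex.exp (h t) = planeToComplex (γ (Circle.exp t)) - planeToComplex p) ∧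
      ∀ t, h (t + 2 * Real.pi) = h t + 2 * Real.pi * Complex.I * d := by
    intro p hp
    obtain ⟨h, hh, hexp⟩ := exists_continuous_log
      (F := fun t : ℝ ↦ planeToComplex (γ (Circle.exp t)) - planeToComplex p)
      ((continuous_planeToComplex.comp (hc.comp (by fun_prop))).sub continuous_const)
      (fun t ↦ planeToComplex_sub_ne_zero fun heq ↦ hp ⟨_, heq⟩)
    have h1 : ∀ t, Complex.exp (h (t + 2 * Real.pi) - h t) = 1 := by
      intro t
      rw [Complex.exp_sub, hexp (t + _), Circle.periodic_exp, ← hexp, div_self]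
      exact Complex.exp_ne_zero _
    obtain ⟨d, hd⟩ := Complex.exp_eq_one_iff.1 (h1 0)
    refine ⟨h, d, hh, hexp, fun t ↦ ?_⟩
    have h2 := eq_of_exp_eq_one isPreconnected_univ
      (w := fun t : ℝ ↦ h (t + 2 * Real.pi) - h t) (by fun_prop) (fun t _ ↦ h1 t) (mem_univ t)
      (mem_univ 0)
    rw [hd] at h2
    linear_combination h2
  have haY : a ∉ range γ := Set.disjoint_left.1 hVY ha
  have hbY : b ∉ range γ := Set.disjoint_left.1 hWY hb
  obtain ⟨h, d, hh, hexp, hper⟩ := hlog a haY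
  obtain ⟨k, e, hk, kexp, kper⟩ := hlog b hbY
  have key : ∀ m n : ℤ, m * d + n * e = 0 → ∃ g : ℝ × ℝ → ℂ, ContinuousOn g (range γ) ∧
      ∀ z ∈ range γ, Complex.exp (g z) =
        (planeToComplex z - planeToComplex a) ^ m *
          (planeToComplex z - planeToComplex b) ^ n := by
    intro m n hmn
    have hP : Function.Periodic (fun t ↦ m * h t + n * k t) (2 * Real.pi) := by
      intro t
      simp only [hper, kper]
      have : (m : ℂ) * d + n * e = 0 := by exact_mod_cast hmn
      linear_combination (2 * Real.pi * Complex.I) * this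
    have hPc : Continuous hP.lift := continuous_coinduced_dom.mpr (by
      change Continuous (fun t ↦ m * h t + n * k t)
      fun_prop)
    refine ⟨fun z ↦ hP.lift (AddCircle.homeomorphCircle'.symm (Function.invFun γ z)),
      (hPc.comp (AddCircle.homeomorphCircle'.symm.continuous)).comp_continuousOn
        (continuousOn_invFun_range hc hi), ?_⟩
    rintro _ ⟨w, rfl⟩
    have h1 : AddCircle.homeomorphCircle'.symm w =
        ((Complex.arg w : ℝ) : AddCircle (2 * Real.pi)) := by
      rw [Homeomorph.symm_apply_eq]
      exact (Circle.exp_arg w).symm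
    simp only [Function.leftInverse_invFun hi w, h1, Function.Periodic.lift_coe]
    rw [Complex.exp_add, Complex.exp_int_mul, Complex.exp_int_mul, hexp, kexp, Circle.exp_arg]
  have hbV : b ∉ closure V := fun hb' ↦
    (hVW.closure_left hW).le_bot ⟨hb', hb⟩
  have haW : a ∉ closure W := fun ha' ↦
    (hVW.symm.closure_left hV).le_bot ⟨ha', ha⟩
  have hm : ∀ m n : ℤ, m * d + n * e = 0 → m = 0 := fun m n hmn ↦ by
    obtain ⟨g, hg, hge⟩ := key m n hmn
    exact exponent_eq_zero_of_log_on_frontier hVb (by rwa [hV.interior_eq]) hbV (hg.mono hVfr)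
      fun z hz ↦ hge z (hVfr hz)
  have hn : ∀ m n : ℤ, m * d + n * e = 0 → n = 0 := fun m n hmn ↦ by
    obtain ⟨g, hg, hge⟩ := key m n hmn
    exact exponent_eq_zero_of_log_on_frontier hWb (by rwa [hW.interior_eq]) haW (hg.mono hWfr)
      fun z hz ↦ by rw [hge z (hWfr hz), mul_comm]
  have he : e = 0 := hm e (-d) (by ring)
  exact one_ne_zero (hn 0 1 (by simp [he]))

lemma IsJordanInterior.isOpen {Y B : Set (ℝ × ℝ)} (hY : IsJordanCurve Y)
    (hB : IsJordanInterior Y B) : IsOpen B := by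
  obtain ⟨-, x, hx, rfl⟩ := hB
  exact hY.isCompact.isClosed.isOpen_compl.connectedComponentIn

lemma IsJordanInterior.isConnected {Y B : Set (ℝ × ℝ)} (hB : IsJordanInterior Y B) :
    IsConnected B := by
  obtain ⟨-, x, hx, rfl⟩ := hB
  exact isConnected_connectedComponentIn_iff.2 hx

lemma IsJordanInterior.subset_compl {Y B : Set (ℝ × ℝ)} (hB : IsJordanInterior Y B) :
    B ⊆ Yᶜ := by
  obtain ⟨-, x, hx, rfl⟩ := hB
  exact connectedComponentIn_subset _ _

lemma IsJordanInterior.subset_of_isPreconnected {Y B S : Set (ℝ × ℝ)}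
    (hB : IsJordanInterior Y B) (hS : IsPreconnected S) (hSY : S ⊆ Yᶜ)
    (hSB : (S ∩ B).Nonempty) : S ⊆ B := by
  obtain ⟨-, x, hx, rfl⟩ := hB
  obtain ⟨z, hzS, hz⟩ := hSB
  rw [connectedComponentIn_eq hz]
  exact hS.subset_connectedComponentIn hzS hSY

lemma IsJordanInterior.frontier_subset {Y B : Set (ℝ × ℝ)} (hY : IsJordanCurve Y)
    (hB : IsJordanInterior Y B) : frontier B ⊆ Y := by
  intro z hz
  have hBo := hB.isOpen hY
  rw [hBo.frontier_eq] at hz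
  by_contra hzY
  have hopen : IsOpen (connectedComponentIn Yᶜ z) :=
    hY.isCompact.isClosed.isOpen_compl.connectedComponentIn
  have hz' : z ∈ connectedComponentIn Yᶜ z := mem_connectedComponentIn hzY
  have hne := mem_closure_iff.1 hz.1 _ hopen hz'
  exact hz.2 (hB.subset_of_isPreconnected isPreconnected_connectedComponentIn
    (connectedComponentIn_subset _ _) hne hz')

/-- A bounded nonempty connected open set whose boundary lies on a Jordan curve is its
interior. -/
lemma IsJordanInterior.eq_of_frontier_subset {Y B V : Set (ℝ × ℝ)} (hY : IsJordanCurve Y)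
    (hB : IsJordanInterior Y B) (hV : IsOpen V) (hVb : Bornology.IsBounded V)
    (hVc : IsConnected V) (hVfr : frontier V ⊆ Y) : V = B := by
  have hVY := hY.disjoint_of_frontier_subset hV hVb hVfr
  have hmeet : (V ∩ B).Nonempty := not_disjoint_iff_nonempty_inter.1 <|
    hY.not_disjoint_of_frontier_subset hV hVb hVc.nonempty hVfr (hB.isOpen hY) hB.1
      hB.isConnected.nonempty (hB.frontier_subset hY)
  refine subset_antisymm
    (hB.subset_of_isPreconnected hVc.isPreconnected hVY.subset_compl_right hmeet) ?_
  refine hB.isConnected.isPreconnected.subset_of_closure_inter_subset hV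
    (by rwa [inter_comm] at hmeet) ?_
  rintro z ⟨hz, hzB⟩
  by_contra hzV
  exact hB.subset_compl hzB (hVfr (by rw [hV.frontier_eq]; exact ⟨hz, hzV⟩))

/-- The image of a Jordan interior under a map as in the main theorem is a Jordan interior. -/
lemma IsJordanInterior.image_eq {X Y BX BY : Set (ℝ × ℝ)}
    (hX : IsJordanCurve X) (hY : IsJordanCurve Y)
    (hBX : IsJordanInterior X BX) (hBY : IsJordanInterior Y BY)
    {f : ℝ × ℝ → ℝ × ℝ} (hfc : ContinuousOn f (closure BX))
    (hloc : IsLocalHomeomorphOn f BX) (hXY : f '' X ⊆ Y) : f '' BX = BY := by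
  have hcpt : IsCompact (f '' closure BX) := hBX.1.isCompact_closure.image_of_continuousOn hfc
  have hsub : f '' BX ⊆ f '' closure BX := image_mono subset_closure
  have hopen : IsOpen (f '' BX) := by
    rw [isOpen_iff_mem_nhds]
    rintro _ ⟨x, hx, rfl⟩
    rw [← hloc.map_nhds_eq hx]
    exact Filter.image_mem_map ((hBX.isOpen hX).mem_nhds hx)
  refine hBY.eq_of_frontier_subset hY hopen (hcpt.isBounded.subset hsub)
    (hBX.isConnected.image _ (hfc.mono subset_closure)) fun y hy ↦ ?_
  rw [hopen.frontier_eq] at hy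
  obtain ⟨x, hx, rfl⟩ := closure_minimal hsub hcpt.isClosed hy.1
  refine hXY (mem_image_of_mem f (hBX.frontier_subset hX ?_))
  rw [(hBX.isOpen hX).frontier_eq]
  exact ⟨hx, fun h ↦ hy.2 (mem_image_of_mem f h)⟩

lemma IsJordanInterior.mem_of_map_mem {X Y BX BY : Set (ℝ × ℝ)}
    (hX : IsJordanCurve X) (hBX : IsJordanInterior X BX) (hBY : IsJordanInterior Y BY)
    {f : ℝ × ℝ → ℝ × ℝ} (hXY : f '' X ⊆ Y) {x : ℝ × ℝ} (hx : x ∈ closure BX)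
    (hfx : f x ∈ BY) : x ∈ BX := by
  by_contra h
  refine hBY.subset_compl hfx (hXY (mem_image_of_mem f (hBX.frontier_subset hX ?_)))
  rw [(hBX.isOpen hX).frontier_eq]
  exact ⟨hx, h⟩

/-- A map as in the main theorem is a covering map over the interior of the target curve. -/
lemma IsJordanInterior.isCoveringMapOn {X Y BX BY : Set (ℝ × ℝ)}
    (hX : IsJordanCurve X) (hBX : IsJordanInterior X BX) (hBY : IsJordanInterior Y BY)
    {f : ℝ × ℝ → ℝ × ℝ} (hfc : ContinuousOn f (closure BX))
    (hloc : IsLocalHomeomorphOn f BX) (hXY : f '' X ⊆ Y) :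
    IsCoveringMapOn ((closure BX).domRestrict f) BY := by
  have : CompactSpace (closure BX) := isCompact_iff_compactSpace.1 hBX.1.isCompact_closure
  have hBXo := hBX.isOpen hX
  have hi : Topology.IsOpenEmbedding (inclusion (subset_closure : BX ⊆ closure BX)) :=
    ⟨Topology.IsEmbedding.inclusion _, by
      rw [range_inclusion]
      exact hBXo.preimage continuous_subtype_val⟩
  have hcomp : IsLocalHomeomorphOn
      ((closure BX).domRestrict f ∘ inclusion (subset_closure : BX ⊆ closure BX)) univ :=
    hloc.comp (hBXo.isOpenEmbedding_subtypeVal.isLocalHomeomorph.isLocalHomeomorphOn)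
      (fun x _ ↦ x.2)
  refine IsCoveringMapOn.of_isLocalHomeomorphOn hfc.domRestrict
    ((hcomp.of_comp_right hi.isLocalHomeomorph.isLocalHomeomorphOn).mono fun x hx ↦ ?_)
  exact ⟨⟨x, hBX.mem_of_map_mem hX hBY hXY x.2 hx⟩, mem_univ _, rfl⟩

/-- `f` has unique lifts, with values in `B`, of continuous maps from convex sets to `U`. -/
def HasConvexLifts (f : ℝ × ℝ → ℝ × ℝ) (B U : Set (ℝ × ℝ)) : Prop :=
  ∀ (E : Type) [NormedAddCommGroup E] [NormedSpace ℝ E] (D : Set E), Convex ℝ D →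
    ∀ φ : E → ℝ × ℝ, ContinuousOn φ D → MapsTo φ D U → ∀ d ∈ D, ∀ x ∈ B, f x = φ d →
      (∃ s : E → ℝ × ℝ, ContinuousOn s D ∧ MapsTo s D B ∧ (∀ z ∈ D, f (s z) = φ z) ∧ s d = x) ∧
      ∀ s s' : E → ℝ × ℝ, ContinuousOn s D → MapsTo s D B → (∀ z ∈ D, f (s z) = φ z) → s d = x →
        ContinuousOn s' D → MapsTo s' D B → (∀ z ∈ D, f (s' z) = φ z) → s' d = x → EqOn s s' D

lemma IsJordanInterior.hasConvexLifts {X Y BX BY : Set (ℝ × ℝ)}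
    (hX : IsJordanCurve X) (hBX : IsJordanInterior X BX) (hBY : IsJordanInterior Y BY)
    {f : ℝ × ℝ → ℝ × ℝ} (hfc : ContinuousOn f (closure BX))
    (hloc : IsLocalHomeomorphOn f BX) (hXY : f '' X ⊆ Y) : HasConvexLifts f BX BY := by
  classical
  intro E _ _ D hD φ hφ hφU d hd x hx hfx
  have := hD.contractibleSpace ⟨d, hd⟩
  have := hD.locallyPathConnectedSpace
  obtain ⟨F, ⟨hFd, hF⟩, huniq⟩ :=
    (hBX.isCoveringMapOn hX hBY hfc hloc hXY).existsUnique_continuousMap_lifts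
      (A := D) ⟨D.domRestrict φ, hφ.domRestrict⟩ (a₀ := ⟨d, hd⟩)
      (e₀ := ⟨x, subset_closure hx⟩) hfx (fun a ↦ hφU a.2)
  have hF' : ∀ z : D, f (F z) = φ z := fun z ↦ congrFun hF z
  have huniq' : ∀ s : E → ℝ × ℝ, ContinuousOn s D → (hs : MapsTo s D BX) →
      (∀ z ∈ D, f (s z) = φ z) → s d = x → ∀ z (hz : z ∈ D), s z = F ⟨z, hz⟩ := by
    intro s hs hsB hsφ hsd z hz
    have h1 := huniq ⟨fun z ↦ ⟨s z, subset_closure (hsB z.2)⟩,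
      hs.domRestrict.subtype_mk _⟩ ⟨Subtype.ext hsd, funext fun z ↦ hsφ z z.2⟩
    rw [← h1]
    rfl
  refine ⟨⟨fun z ↦ if h : z ∈ D then F ⟨z, h⟩ else 0, ?_, ?_, ?_, ?_⟩, ?_⟩
  · rw [continuousOn_iff_continuous_domRestrict]
    convert continuous_subtype_val.comp F.continuous using 1
    funext z
    simp
  · intro z hz
    simp only [hz, dite_true]
    exact hBX.mem_of_map_mem hX hBY hXY (F _).2 ((hF' ⟨z, hz⟩).symm ▸ hφU hz)
  · intro z hz
    simpa [hz] using hF' ⟨z, hz⟩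
  · simp [hd, hFd]
  · intro s s' h1 h2 h3 h4 h1' h2' h3' h4' z hz
    rw [huniq' s h1 h2 h3 h4 z hz, huniq' s' h1' h2' h3' h4' z hz]

/-- `x` and `y` lie on the same continuous local section of `f` over a convex subset of `U`. -/
def SameSheet (f : ℝ × ℝ → ℝ × ℝ) (B U : Set (ℝ × ℝ)) (x y : ℝ × ℝ) : Prop :=
  ∃ C ⊆ U, Convex ℝ C ∧ f x ∈ C ∧ f y ∈ C ∧ ∃ s : ℝ × ℝ → ℝ × ℝ,
    ContinuousOn s C ∧ MapsTo s C B ∧ (∀ z ∈ C, f (s z) = z) ∧ s (f x) = x ∧ s (f y) = y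

namespace SameSheet

variable {f : ℝ × ℝ → ℝ × ℝ} {B U : Set (ℝ × ℝ)} {x y z : ℝ × ℝ}

lemma symm (h : SameSheet f B U x y) : SameSheet f B U y x := by
  obtain ⟨C, hC, hCc, hx, hy, s, h1, h2, h3, h4, h5⟩ := h
  exact ⟨C, hC, hCc, hy, hx, s, h1, h2, h3, h5, h4⟩

lemma mem_left (h : SameSheet f B U x y) : x ∈ B := by
  obtain ⟨C, hC, hCc, hx, hy, s, h1, h2, h3, h4, h5⟩ := h
  exact h4 ▸ h2 hx

lemma mem_right (h : SameSheet f B U x y) : y ∈ B := h.symm.mem_left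

lemma segment_subset (h : SameSheet f B U x y) : segment ℝ (f x) (f y) ⊆ U := by
  obtain ⟨C, hC, hCc, hx, hy, -⟩ := h
  exact (hCc.segment_subset hx hy).trans hC

/-- Two points on the same sheet lie on the same section over every convex set containing
their images. -/
lemma section_apply (hL : HasConvexLifts f B U) (h : SameSheet f B U x y) {C : Set (ℝ × ℝ)}
    (hC : Convex ℝ C) (hCU : C ⊆ U) (hx : f x ∈ C) (hy : f y ∈ C) {s : ℝ × ℝ → ℝ × ℝ}
    (hs : ContinuousOn s C) (hsB : MapsTo s C B) (hsf : ∀ z ∈ C, f (s z) = z)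
    (hsx : s (f x) = x) : s (f y) = y := by
  have hxB := h.mem_left
  obtain ⟨C', hCU', hC', hx', hy', s', h1, h2, h3, h4, h5⟩ := h
  have := (hL (ℝ × ℝ) (C ∩ C') (hC.inter hC') id continuousOn_id (fun z hz ↦ hCU hz.1)
    (f x) ⟨hx, hx'⟩ x hxB rfl).2 s s' (hs.mono inter_subset_left)
    (hsB.mono_left inter_subset_left) (fun z hz ↦ hsf z hz.1) hsx (h1.mono inter_subset_right)
    (h2.mono_left inter_subset_right) (fun z hz ↦ h3 z hz.2) h4 ⟨hy, hy'⟩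
  exact this.trans h5

lemma unique (hL : HasConvexLifts f B U) (h : SameSheet f B U x y) (h' : SameSheet f B U x z)
    (hyz : f y = f z) : y = z := by
  have h'' := h
  obtain ⟨C, hC, hCc, hx, hy, s, h1, h2, h3, h4, h5⟩ := h''
  rw [← h5, hyz]
  exact h'.section_apply hL hCc hC hx (hyz ▸ hy) h1 h2 h3 h4

lemma exists_of_convex (hL : HasConvexLifts f B U) (hx : x ∈ B) {C : Set (ℝ × ℝ)}
    (hC : Convex ℝ C) (hCU : C ⊆ U) (hfx : f x ∈ C) {b : ℝ × ℝ} (hb : b ∈ C) :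
    ∃ y, f y = b ∧ SameSheet f B U x y := by
  obtain ⟨s, h1, h2, h3, h4⟩ := (hL (ℝ × ℝ) C hC id continuousOn_id hCU (f x) hfx x hx rfl).1
  refine ⟨s b, h3 b hb, C, hCU, hC, hfx, ?_, s, h1, h2, h3, h4, ?_⟩
  · rw [h3 b hb]; exact hb
  · rw [h3 b hb]; rfl

lemma trans_of_convex (hL : HasConvexLifts f B U) (h : SameSheet f B U x y)
    (h' : SameSheet f B U y z) {C : Set (ℝ × ℝ)} (hC : Convex ℝ C) (hCU : C ⊆ U)
    (hx : f x ∈ C) (hy : f y ∈ C) (hz : f z ∈ C) : SameSheet f B U x z := by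
  obtain ⟨s, h1, h2, h3, h4⟩ :=
    (hL (ℝ × ℝ) C hC id continuousOn_id hCU (f x) hx x h.mem_left rfl).1
  have hy' := h.section_apply hL hC hCU hx hy h1 h2 h3 h4
  exact ⟨C, hCU, hC, hx, hz, s, h1, h2, h3, h4,
    h'.section_apply hL hC hCU hy hz h1 h2 h3 hy'⟩

/-- Points joined by a path over a convex set lie on the same sheet. -/
lemma of_path (hL : HasConvexLifts f B U) (hf : ContinuousOn f B) {I : Set ℝ} (hI : Convex ℝ I)
    {σ : ℝ → ℝ × ℝ} (hσ : ContinuousOn σ I) (hσB : MapsTo σ I B) {C : Set (ℝ × ℝ)}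
    (hC : Convex ℝ C) (hCU : C ⊆ U) (hσC : ∀ t ∈ I, f (σ t) ∈ C) {t₀ t₁ : ℝ} (h₀ : t₀ ∈ I)
    (h₁ : t₁ ∈ I) : SameSheet f B U (σ t₀) (σ t₁) := by
  obtain ⟨s, h1, h2, h3, h4⟩ := (hL (ℝ × ℝ) C hC id continuousOn_id hCU (f (σ t₀))
    (hσC _ h₀) (σ t₀) (hσB h₀) rfl).1
  have hfσ : ContinuousOn (fun t ↦ f (σ t)) I := hf.comp hσ hσB
  have := (hL ℝ I hI (fun t ↦ f (σ t)) hfσ (fun t ht ↦ hCU (hσC t ht)) t₀ h₀ (σ t₀) (hσB h₀)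
    rfl).2 (fun t ↦ s (f (σ t))) σ (h1.comp hfσ hσC) (fun t ht ↦ h2 (hσC t ht))
    (fun t ht ↦ h3 _ (hσC t ht)) h4 hσ hσB (fun _ _ ↦ rfl) rfl h₁
  exact ⟨C, hCU, hC, hσC _ h₀, hσC _ h₁, s, h1, h2, h3, h4, this⟩

end SameSheet

/-- `z - p` has a continuous logarithm on `K`. -/
def HasLogSub (K : Set (ℝ × ℝ)) (p : ℝ × ℝ) : Prop :=
  ∃ L : ℝ × ℝ → ℂ, ContinuousOn L K ∧
    ∀ z ∈ K, Complex.exp (L z) = planeToComplex z - planeToComplex p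

namespace HasLogSub

variable {K : Set (ℝ × ℝ)} {p q : ℝ × ℝ}

lemma one_sub_mem_slitPlane {u v : ℂ} (h : ‖u‖ < ‖v‖) : 1 - u / v ∈ Complex.slitPlane := by
  refine Complex.mem_slitPlane_of_norm_lt_one (z := -(u / v)) ?_ |> fun h ↦ by
    simpa [sub_eq_add_neg] using h
  rw [norm_neg, norm_div]
  exact (div_lt_one ((norm_nonneg u).trans_lt h)).2 h

lemma of_norm_lt (h : ∀ z ∈ K, ‖planeToComplex z‖ < ‖planeToComplex p‖) : HasLogSub K p := by
  have hc := continuous_planeToComplex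
  refine ⟨fun z ↦ Complex.log (-planeToComplex p) +
    Complex.log (1 - planeToComplex z / planeToComplex p), ?_, fun z hz ↦ ?_⟩
  · exact continuousOn_const.add
      (ContinuousOn.clog (by fun_prop) fun z hz ↦ one_sub_mem_slitPlane (h z hz))
  · have hp : planeToComplex p ≠ 0 := norm_pos_iff.1 ((norm_nonneg _).trans_lt (h z hz))
    rw [Complex.exp_add, Complex.exp_log (neg_ne_zero.2 hp),
      Complex.exp_log (Complex.slitPlane_ne_zero (one_sub_mem_slitPlane (h z hz)))]
    field_simp
    ring

lemma of_norm_sub_lt (hp : HasLogSub K p) (h : ∀ z ∈ K,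
    ‖planeToComplex q - planeToComplex p‖ < ‖planeToComplex z - planeToComplex p‖) :
    HasLogSub K q := by
  obtain ⟨L, hL, hexp⟩ := hp
  have hc := continuous_planeToComplex
  have h0 : ∀ z ∈ K, planeToComplex z - planeToComplex p ≠ 0 := fun z hz ↦
    norm_pos_iff.1 ((norm_nonneg _).trans_lt (h z hz))
  refine ⟨fun z ↦ L z + Complex.log (1 - (planeToComplex q - planeToComplex p) /
    (planeToComplex z - planeToComplex p)), ?_, fun z hz ↦ ?_⟩
  · refine hL.add (ContinuousOn.clog ?_ fun z hz ↦ one_sub_mem_slitPlane (h z hz))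
    exact continuousOn_const.sub (continuousOn_const.div (by fun_prop) h0)
  · have := h0 z hz
    rw [Complex.exp_add, hexp z hz,
      Complex.exp_log (Complex.slitPlane_ne_zero (one_sub_mem_slitPlane (h z hz)))]
    field_simp
    ring

lemma eventually_iff (hK : IsCompact K) (hp : p ∉ K) :
    ∀ᶠ q in nhds p, HasLogSub K p ↔ HasLogSub K q := by
  have hc := continuous_planeToComplex
  have hcl : IsClosed (planeToComplex '' K) := (hK.image hc).isClosed
  have hmem : (planeToComplex '' K)ᶜ ∈ nhds (planeToComplex p) :=
    hcl.isOpen_compl.mem_nhds fun ⟨z, hz, h⟩ ↦ hp (planeToComplex_injective h ▸ hz)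
  obtain ⟨d, hd, hball⟩ := Metric.mem_nhds_iff.1 hmem
  have hfar : ∀ z ∈ K, d ≤ ‖planeToComplex z - planeToComplex p‖ := fun z hz ↦ by
    by_contra! h
    exact hball (mem_ball_iff_norm.2 h) ⟨z, hz, rfl⟩
  filter_upwards [hc.continuousAt.preimage_mem_nhds (Metric.ball_mem_nhds _ (half_pos hd))]
    with q hq
  rw [mem_preimage, mem_ball_iff_norm] at hq
  refine ⟨fun h ↦ h.of_norm_sub_lt fun z hz ↦ by linarith [hfar z hz],
    fun h ↦ h.of_norm_sub_lt fun z hz ↦ ?_⟩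
  have h1 := hfar z hz
  have h2 := norm_add_le (planeToComplex z - planeToComplex q)
    (planeToComplex q - planeToComplex p)
  rw [sub_add_sub_cancel] at h2
  rw [norm_sub_rev]
  linarith

/-- Along a connected set avoiding `K`, logarithms of `z - p` exist for all `p` or for none. -/
lemma of_isPreconnected (hK : IsCompact K) {T : Set (ℝ × ℝ)} (hT : IsPreconnected T)
    (hKT : Disjoint T K) (hp : p ∈ T) (hq : q ∈ T) (h : HasLogSub K p) : HasLogSub K q := by
  have hopen : ∀ P : Prop, IsOpen {p | p ∉ K ∧ (HasLogSub K p ↔ P)} := fun P ↦ by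
    rw [isOpen_iff_mem_nhds]
    rintro p ⟨hp, hP⟩
    filter_upwards [eventually_iff hK hp, hK.isClosed.isOpen_compl.mem_nhds hp] with q h1 h2
    exact ⟨h2, h1.symm.trans hP⟩
  have := hT.subset_left_of_subset_union (hopen True) (hopen False)
    (Set.disjoint_left.2 fun x h1 h2 ↦ by simp_all)
    (fun x hx ↦ by have := Set.disjoint_left.1 hKT hx; by_cases h : HasLogSub K x <;> simp [*])
    ⟨p, hp, Set.disjoint_left.1 hKT hp, by simpa⟩ hq
  simpa using this.2

end HasLogSub

/-- The horizontal ray pointing right from `p`. -/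
def rightRay (p : ℝ × ℝ) : Set (ℝ × ℝ) := (fun t : ℝ ↦ (p.1 + t, p.2)) '' Ici 0

lemma isPreconnected_rightRay (p : ℝ × ℝ) : IsPreconnected (rightRay p) :=
  isPreconnected_Ici.image _ (by fun_prop)

lemma HasLogSub.of_disjoint_rightRay {K : Set (ℝ × ℝ)} (hK : IsCompact K) {p : ℝ × ℝ}
    (h : Disjoint (rightRay p) K) : HasLogSub K p := by
  obtain ⟨R, hR⟩ := (hK.image continuous_planeToComplex).isBounded.exists_norm_le
  refine HasLogSub.of_isPreconnected hK (isPreconnected_rightRay p) h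
    ⟨|p.1| + |R| + 1, mem_Ici.2 (by positivity), rfl⟩ ⟨0, self_mem_Ici, by simp⟩
    (.of_norm_lt fun z hz ↦ ?_)
  have h1 := hR _ (mem_image_of_mem _ hz)
  have h2 := Complex.abs_re_le_norm (planeToComplex (p.1 + (|p.1| + |R| + 1), p.2))
  have h3 : (planeToComplex (p.1 + (|p.1| + |R| + 1), p.2)).re = p.1 + (|p.1| + |R| + 1) := rfl
  rw [h3] at h2
  have := le_abs_self R
  have := neg_abs_le p.1
  have := le_abs_self (p.1 + (|p.1| + |R| + 1))
  linarith

lemma IsJordanInterior.disjoint_rightRay {Y B : Set (ℝ × ℝ)} (hB : IsJordanInterior Y B)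
    {p : ℝ × ℝ} (h : Disjoint (rightRay p) Y) : Disjoint (rightRay p) B := by
  rw [Set.disjoint_iff_inter_eq_empty]
  by_contra hne
  have hsub := hB.subset_of_isPreconnected (isPreconnected_rightRay p) h.subset_compl_right
    (nonempty_iff_ne_empty.2 hne)
  obtain ⟨R, hR⟩ := hB.1.exists_norm_le
  have h1 := hR _ (hsub ⟨|p.1| + |R| + 1, mem_Ici.2 (by positivity), rfl⟩)
  have h2 := (norm_fst_le _).trans h1
  have := le_abs_self R
  have := neg_abs_le p.1
  have := le_abs_self (p.1 + (|p.1| + |R| + 1))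
  rw [Real.norm_eq_abs] at h2
  dsimp only at h2
  linarith

/-- The interior of a Jordan curve has no holes: no compact subset of it winds around a point
outside it. -/
lemma IsJordanInterior.hasLogSub {Y B : Set (ℝ × ℝ)} (hY : IsJordanCurve Y)
    (hB : IsJordanInterior Y B) {K : Set (ℝ × ℝ)} (hK : IsCompact K) (hKB : K ⊆ B) {p : ℝ × ℝ}
    (hp : p ∉ B) : HasLogSub K p := by
  have hYc := hY.isCompact
  have hYB : Disjoint Y B := (disjoint_left.2 fun y h1 h2 ↦ hB.subset_compl h2 h1)
  have hYK : Disjoint Y K := hYB.mono_right hKB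
  have hray : ∀ p, Disjoint (rightRay p) Y → HasLogSub K p := fun p h ↦
    .of_disjoint_rightRay hK ((hB.disjoint_rightRay h).mono_right hKB)
  -- The point of `Y` furthest to the right.
  have hgoodY : ∀ y ∈ Y, HasLogSub K y := by
    intro y hy
    obtain ⟨m, hm, hmax⟩ := hYc.exists_isMaxOn ⟨y, hy⟩ continuous_fst.continuousOn
    refine HasLogSub.of_isPreconnected hK hY.isPreconnected hYK hm hy ?_
    have hmK : m ∉ K := disjoint_left.1 hYK hm
    have hev := HasLogSub.eventually_iff hK hmK
    have hcont : Filter.Tendsto (fun t : ℝ ↦ (m.1 + t, m.2)) (nhdsWithin 0 (Ioi 0)) (nhds m) := by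
      have : ContinuousAt (fun t : ℝ ↦ (m.1 + t, m.2)) 0 := by fun_prop
      have h2 := this.tendsto
      simp only [add_zero] at h2
      exact h2.mono_left nhdsWithin_le_nhds
    obtain ⟨t, ht, ht0⟩ := ((hcont.eventually hev).and self_mem_nhdsWithin).exists
    refine ht.2 (hray _ (disjoint_left.2 ?_))
    rintro _ ⟨s, hs, rfl⟩ hsY
    have h1 : m.1 + t + s ≤ m.1 := hmax hsY
    have hs0 : 0 ≤ s := hs
    have ht1 : 0 < t := ht0
    linarith
  by_cases hpr : Disjoint (rightRay p) Y
  · exact hray p hpr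
  -- The first point of `Y` on the ray.
  let S : Set ℝ := Ici 0 ∩ (fun t : ℝ ↦ (p.1 + t, p.2)) ⁻¹' Y
  have hSc : IsClosed S := isClosed_Ici.inter (hYc.isClosed.preimage (by fun_prop))
  have hSn : S.Nonempty := by
    obtain ⟨_, ⟨t, ht, rfl⟩, htY⟩ := not_disjoint_iff.1 hpr
    exact ⟨t, ht, htY⟩
  have hSb : BddBelow S := ⟨0, fun t ht ↦ ht.1⟩
  have htS := hSc.csInf_mem hSn hSb
  set t := sInf S
  refine HasLogSub.of_isPreconnected hK (T := (fun s : ℝ ↦ (p.1 + s, p.2)) '' Icc 0 t)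
    (isPreconnected_Icc.image _ (by fun_prop)) ?_ ⟨t, ⟨htS.1, le_rfl⟩, rfl⟩
    ⟨0, ⟨le_rfl, htS.1⟩, by simp⟩ (hgoodY _ htS.2)
  refine Disjoint.mono_right hKB (disjoint_left.2 ?_)
  rintro _ ⟨s, hs, rfl⟩ hsB
  rcases hs.2.eq_or_lt with h | h
  · exact hB.subset_compl hsB (h ▸ htS.2)
  refine hp (hB.subset_of_isPreconnected (S := (fun r : ℝ ↦ (p.1 + r, p.2)) '' Icc 0 s)
    (isPreconnected_Icc.image _ (by fun_prop)) ?_ ⟨_, ⟨s, ⟨hs.1, le_rfl⟩, rfl⟩, hsB⟩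
    ⟨0, ⟨le_rfl, hs.1⟩, by simp⟩)
  rintro _ ⟨r, hr, rfl⟩ hrY
  exact absurd (csInf_le hSb ⟨hr.1, hrY⟩) (not_le.2 (hr.2.trans_lt h))

/-- The point with integer coordinates `v` of the square grid with mesh `δ`. -/
def gridPoint (δ : ℝ) (v : ℤ × ℤ) : ℝ × ℝ := (δ * v.1, δ * v.2)

/-- Neighbouring vertices of the square grid. -/
def GridAdj (v w : ℤ × ℤ) : Prop :=
  (v.1 = w.1 ∧ (w.2 = v.2 + 1 ∨ v.2 = w.2 + 1)) ∨ (v.2 = w.2 ∧ (w.1 = v.1 + 1 ∨ v.1 = w.1 + 1))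

lemma GridAdj.of_mem_segment {δ : ℝ} (hδ : 0 < δ) {v w : ℤ × ℤ} (h : GridAdj v w) {z : ℝ × ℝ}
    (hz : z ∈ segment ℝ (gridPoint δ v) (gridPoint δ w)) :
    (z.1 = δ * v.1 ∧ v.1 = w.1) ∨ (z.2 = δ * v.2 ∧ v.2 = w.2 ∧
      ((w.1 = v.1 + 1 ∧ δ * v.1 ≤ z.1 ∧ z.1 ≤ δ * (v.1 + 1)) ∨
        (v.1 = w.1 + 1 ∧ δ * w.1 ≤ z.1 ∧ z.1 ≤ δ * (w.1 + 1)))) := by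
  obtain ⟨s, t, hs, ht, hst, rfl⟩ := hz
  obtain rfl : s = 1 - t := by linarith
  have h1 : 0 ≤ δ * t := by positivity
  have h2 : 0 ≤ δ * (1 - t) := by positivity
  rcases h with ⟨h, -⟩ | ⟨h, h' | h'⟩
  · left
    simp only [gridPoint, Prod.smul_mk, Prod.mk_add_mk, smul_eq_mul, h, and_true]
    ring
  · right
    simp only [gridPoint, Prod.smul_mk, Prod.mk_add_mk, smul_eq_mul, h, h', true_and]
    push_cast
    refine ⟨by ring, Or.inl ⟨?_, ?_⟩⟩ <;> nlinarith
  · right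
    simp only [gridPoint, Prod.smul_mk, Prod.mk_add_mk, smul_eq_mul, h, h', true_and]
    push_cast
    refine ⟨by ring, Or.inr ⟨?_, ?_⟩⟩ <;> nlinarith

/-- The centre of a grid square, given its upper right corner. -/
noncomputable def gridCenter (δ : ℝ) (a b : ℤ) : ℝ × ℝ := (δ * (a - 1 / 2), δ * (b - 1 / 2))

lemma GridAdj.le_abs_sub {δ : ℝ} (hδ : 0 < δ) {v w : ℤ × ℤ} (h : GridAdj v w) {z : ℝ × ℝ}
    (hz : z ∈ segment ℝ (gridPoint δ v) (gridPoint δ w)) (a b : ℤ) :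
    δ / 2 ≤ |z.1 - (gridCenter δ a b).1| ∨ δ / 2 ≤ |z.2 - (gridCenter δ a b).2| := by
  have key : ∀ m c : ℤ, δ / 2 ≤ |δ * m - δ * (c - 1 / 2)| := by
    intro m c
    have : δ * m - δ * (c - 1 / 2) = δ * (m - c + 1 / 2) := by ring
    rw [this, abs_mul, abs_of_pos hδ, div_eq_mul_one_div]
    refine mul_le_mul_of_nonneg_left ?_ hδ.le
    rcases le_or_gt c m with h | h
    · have : (c : ℝ) ≤ m := by exact_mod_cast h
      exact (by linarith : (1 : ℝ) / 2 ≤ m - c + 1 / 2).trans (le_abs_self _)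
    · have : (m : ℝ) + 1 ≤ c := by exact_mod_cast h
      exact (by linarith : (1 : ℝ) / 2 ≤ -(m - c + 1 / 2)).trans (neg_le_abs _)
  rcases h.of_mem_segment hδ hz with h | h
  · left; rw [h.1]; exact key _ _
  · right; rw [h.1]; exact key _ _

lemma GridAdj.of_mem_segment_above {δ : ℝ} (hδ : 0 < δ) {v w : ℤ × ℤ} (h : GridAdj v w)
    {z : ℝ × ℝ} (hz : z ∈ segment ℝ (gridPoint δ v) (gridPoint δ w)) {a b : ℤ}
    (h1 : z.1 = (gridCenter δ a b).1) (h2 : (gridCenter δ a b).2 ≤ z.2) :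
    v.2 = w.2 ∧ b ≤ v.2 ∧ ((v.1 = a - 1 ∧ w.1 = a) ∨ (v.1 = a ∧ w.1 = a - 1)) := by
  simp only [gridCenter] at h1 h2
  have hcancel : ∀ x y : ℝ, δ * x ≤ δ * y → x ≤ y := fun x y h ↦ le_of_mul_le_mul_left h hδ
  have hbetween : ∀ m c : ℤ, (m : ℝ) ≤ c - 1 / 2 → (c : ℝ) - 1 / 2 ≤ m + 1 → m = c - 1 := by
    intro m c h h'
    have h3 : (m : ℝ) < c := by linarith
    have h4 : (c : ℝ) < m + 2 := by linarith
    have h3' : m < c := by exact_mod_cast h3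
    have h4' : c < m + 2 := by exact_mod_cast h4
    omega
  rcases h.of_mem_segment hδ hz with ⟨h3, -⟩ | ⟨h3, h4, h5⟩
  · rw [h1] at h3
    have h3' := mul_left_cancel₀ hδ.ne' h3
    have h6 := hbetween v.1 a (by linarith) (by linarith)
    rw [h6] at h3'
    push_cast at h3'
    linarith
  · rw [h3] at h2
    have h6 := hcancel _ _ h2
    refine ⟨h4, ?_, ?_⟩
    · have h7 : (b : ℝ) < v.2 + 1 := by linarith
      have h8 : b < v.2 + 1 := by exact_mod_cast h7
      omega
    · rw [h1] at h5
      rcases h5 with ⟨h7, h8, h9⟩ | ⟨h7, h8, h9⟩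
      · have := hbetween v.1 a (hcancel _ _ h8) (hcancel _ _ h9)
        omega
      · have := hbetween w.1 a (hcancel _ _ h8) (hcancel _ _ h9)
        omega


/-- A closed grid walk traversing the top side of a square exactly once, with no other edge above
that square's centre, winds around the centre: no logarithm of `z - q` exists on it. -/
lemma not_hasLogSub_gridCenter {δ : ℝ} (hδ : 0 < δ) {n : ℕ} {v : ℕ → ℤ × ℤ} (hn : v n = v 0)
    (hadj : ∀ i < n, GridAdj (v i) (v (i + 1))) {K : Set (ℝ × ℝ)}
    (hK : ∀ i < n, segment ℝ (gridPoint δ (v i)) (gridPoint δ (v (i + 1))) ⊆ K)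
    {e : ℕ} (he : e < n) {a b : ℤ}
    (hev : (v e = (a - 1, b) ∧ v (e + 1) = (a, b)) ∨ (v e = (a, b) ∧ v (e + 1) = (a - 1, b)))
    (hmax : ∀ i < n, (v i).2 ≤ b)
    (honly : ∀ i < n, (v i = (a - 1, b) ∧ v (i + 1) = (a, b)) ∨
      (v i = (a, b) ∧ v (i + 1) = (a - 1, b)) → i = e) :
    ¬ HasLogSub K (gridCenter δ a b) := by
  rintro ⟨L, hL, hexp⟩
  have hc := continuous_planeToComplex
  set q := gridCenter δ a b with hq
  have hseg : ∀ i, IsPreconnected (segment ℝ (gridPoint δ (v i)) (gridPoint δ (v (i + 1)))) :=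
    fun i ↦ (convex_segment _ _).isPreconnected
  have hre : ∀ z : ℝ × ℝ, (planeToComplex z - planeToComplex q).re = z.1 - q.1 := fun z ↦ rfl
  have him : ∀ z : ℝ × ℝ, (planeToComplex z - planeToComplex q).im = z.2 - q.2 := fun z ↦ rfl
  have h0 : ∀ i < n, ∀ z ∈ segment ℝ (gridPoint δ (v i)) (gridPoint δ (v (i + 1))),
      planeToComplex z - planeToComplex q ≠ 0 := by
    intro i hi z hz
    rcases (hadj i hi).le_abs_sub hδ hz a b with h | h
    · refine fun h0 ↦ ?_
      rw [← hre, h0] at h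
      simp at h
      linarith
    · refine fun h0 ↦ ?_
      rw [← him, h0] at h
      simp at h
      linarith
  -- Away from the top edge, compare with the logarithm cut along the upward ray.
  have hstep : ∀ i < n, i ≠ e →
      L (gridPoint δ (v i)) -
        Complex.log ((planeToComplex (gridPoint δ (v i)) - planeToComplex q) * Complex.I) =
      L (gridPoint δ (v (i + 1))) -
        Complex.log ((planeToComplex (gridPoint δ (v (i + 1))) - planeToComplex q)
          * Complex.I) := by
    intro i hi hie
    have := eq_of_exp_eq_one (hseg i) (w := fun z ↦ L z -
      Complex.log ((planeToComplex z - planeToComplex q) * Complex.I) + Real.pi / 2 * Complex.I)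
      ?_ ?_ (left_mem_segment _ _ _) (right_mem_segment _ _ _)
    · simpa using this
    · refine ((hL.mono (hK i hi)).sub (ContinuousOn.clog (by fun_prop) fun z hz ↦ ?_)).add
        continuousOn_const
      by_contra hsl
      rw [Complex.mem_slitPlane_iff] at hsl
      push Not at hsl
      simp only [Complex.mul_re, Complex.mul_im, Complex.I_re, Complex.I_im, hre, him] at hsl
      obtain ⟨h1, h2, h3⟩ := (hadj i hi).of_mem_segment_above hδ hz (a := a) (b := b)
        (by linarith [hsl.2]) (by linarith [hsl.1])
      have h4 := hmax i hi
      refine hie (honly i hi (h3.imp (fun h ↦ ⟨?_, ?_⟩) (fun h ↦ ⟨?_, ?_⟩))) <;>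
        ext <;> simp only <;> omega
    · intro z hz
      have hz0 := h0 i hi z hz
      rw [Complex.exp_add, Complex.exp_sub, hexp z (hK i hi hz),
        Complex.exp_log (mul_ne_zero hz0 Complex.I_ne_zero), Complex.exp_pi_div_two_mul_I]
      field_simp
  have hleft : ∀ i ≤ e, L (gridPoint δ (v i)) -
        Complex.log ((planeToComplex (gridPoint δ (v i)) - planeToComplex q) * Complex.I) =
      L (gridPoint δ (v 0)) -
        Complex.log ((planeToComplex (gridPoint δ (v 0)) - planeToComplex q) * Complex.I) := by
    intro i
    induction i with
    | zero => exact fun _ ↦ rfl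
    | succ i ih => exact fun h ↦ (hstep i (by omega) (by omega)).symm.trans (ih (by omega))
  have hright : ∀ i, e + 1 ≤ i → i ≤ n → L (gridPoint δ (v i)) -
        Complex.log ((planeToComplex (gridPoint δ (v i)) - planeToComplex q) * Complex.I) =
      L (gridPoint δ (v (e + 1))) -
        Complex.log ((planeToComplex (gridPoint δ (v (e + 1))) - planeToComplex q)
          * Complex.I) := by
    intro i hi
    induction i, hi using Nat.le_induction with
    | base => exact fun _ ↦ rfl
    | succ i hi ih => exact fun h ↦ (hstep i (by omega) (by omega)).symm.trans (ih (by omega))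
  have hround := (hleft e le_rfl).trans (hn ▸ hright n he le_rfl)
  -- On the top edge, compare with the principal logarithm.
  have htop : L (gridPoint δ (v e)) -
        Complex.log (planeToComplex (gridPoint δ (v e)) - planeToComplex q) =
      L (gridPoint δ (v (e + 1))) -
        Complex.log (planeToComplex (gridPoint δ (v (e + 1))) - planeToComplex q) := by
    refine eq_of_exp_eq_one (hseg e) (w := fun z ↦ L z -
      Complex.log (planeToComplex z - planeToComplex q)) ?_ ?_ (left_mem_segment _ _ _)
      (right_mem_segment _ _ _)
    · refine (hL.mono (hK e he)).sub (ContinuousOn.clog (by fun_prop) fun z hz ↦ Or.inr ?_)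
      have h2 : z.2 = δ * b := by
        obtain ⟨s, t, hs, ht, hst, rfl⟩ := hz
        rcases hev with ⟨h1, h2⟩ | ⟨h1, h2⟩ <;>
        · simp only [gridPoint, h1, h2, Prod.smul_mk, Prod.mk_add_mk, smul_eq_mul]
          rw [← add_mul, hst, one_mul]
      rw [him, h2, hq, gridCenter]
      have : δ * (b : ℝ) - δ * (b - 1 / 2) = δ / 2 := by ring
      rw [this]
      positivity
    · intro z hz
      have hz0 := h0 e he z hz
      rw [Complex.exp_sub, hexp z (hK e he hz), Complex.exp_log hz0, div_self hz0]
  set l := planeToComplex (gridPoint δ (a - 1, b)) - planeToComplex q with hl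
  set r := planeToComplex (gridPoint δ (a, b)) - planeToComplex q with hr
  have hlre : l.re = -(δ / 2) := by
    rw [hl, hre, hq, gridCenter, gridPoint]; push_cast; ring
  have hlim : l.im = δ / 2 := by
    rw [hl, him, hq, gridCenter, gridPoint]; ring
  have hrre : r.re = δ / 2 := by
    rw [hr, hre, hq, gridCenter, gridPoint]; ring
  have hrim : r.im = δ / 2 := by
    rw [hr, him, hq, gridCenter, gridPoint]; ring
  have hmain : Complex.log (r * Complex.I) - Complex.log (l * Complex.I) =
      Complex.log r - Complex.log l := by
    rcases hev with ⟨h1, h2⟩ | ⟨h1, h2⟩ <;> rw [h1, h2, ← hl, ← hr] at hround htop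
    · linear_combination hround - htop
    · linear_combination htop - hround
  have harg := congrArg Complex.im hmain
  simp only [Complex.sub_im, Complex.log_im] at harg
  have e1 : 0 ≤ (r * Complex.I).arg := Complex.arg_nonneg_iff.2 (by simp [hrre]; positivity)
  have e2 : (l * Complex.I).arg < 0 := Complex.arg_neg_iff.2 (by simp [hlre]; positivity)
  have e3 : |r.arg| ≤ Real.pi / 2 := Complex.abs_arg_le_pi_div_two_iff.2 (by
    rw [hrre]; positivity)
  have e4 : ¬ |l.arg| ≤ Real.pi / 2 := fun h ↦ by
    have := Complex.abs_arg_le_pi_div_two_iff.1 h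
    linarith
  have e5 : 0 ≤ l.arg := Complex.arg_nonneg_iff.2 (by rw [hlim]; positivity)
  rw [abs_of_nonneg e5] at e4
  linarith [le_abs_self r.arg]

/-- The square below the topmost edge of a closed grid walk lies in every set `U` that contains
the walk and has no holes. -/
lemma gridSquare_subset {δ : ℝ} (hδ : 0 < δ) {U : Set (ℝ × ℝ)}
    (hU : ∀ K ⊆ U, IsCompact K → ∀ p ∉ U, HasLogSub K p) {n : ℕ} {v : ℕ → ℤ × ℤ} (hn : v n = v 0)
    (hadj : ∀ i < n, GridAdj (v i) (v (i + 1)))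
    (hseg : ∀ i < n, segment ℝ (gridPoint δ (v i)) (gridPoint δ (v (i + 1))) ⊆ U)
    {e : ℕ} (he : e < n) {a b : ℤ}
    (hev : (v e = (a - 1, b) ∧ v (e + 1) = (a, b)) ∨ (v e = (a, b) ∧ v (e + 1) = (a - 1, b)))
    (hmax : ∀ i < n, (v i).2 ≤ b)
    (honly : ∀ i < n, (v i = (a - 1, b) ∧ v (i + 1) = (a, b)) ∨
      (v i = (a, b) ∧ v (i + 1) = (a - 1, b)) → i = e) :
    Icc (gridPoint δ (a - 1, b - 1)) (gridPoint δ (a, b)) ⊆ U := by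
  intro p hp
  by_contra hpU
  let K : Set (ℝ × ℝ) :=
    ⋃ i ∈ Finset.range n, segment ℝ (gridPoint δ (v i)) (gridPoint δ (v (i + 1)))
  have hK : IsCompact K := (Finset.range n).isCompact_biUnion fun i _ ↦ by
    rw [← convexHull_pair (𝕜 := ℝ)]
    exact (Set.toFinite _).isCompact_convexHull (𝕜 := ℝ)
  have hKU : K ⊆ U := iUnion₂_subset fun i hi ↦ hseg i (Finset.mem_range.1 hi)
  have hKi : ∀ i < n, segment ℝ (gridPoint δ (v i)) (gridPoint δ (v (i + 1))) ⊆ K := fun i hi ↦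
    subset_biUnion_of_mem (u := fun i ↦
      segment ℝ (gridPoint δ (v i)) (gridPoint δ (v (i + 1)))) (Finset.mem_range.2 hi)
  refine not_hasLogSub_gridCenter hδ hn hadj hKi he hev hmax honly
    (HasLogSub.of_isPreconnected hK (convex_segment p (gridCenter δ a b)).isPreconnected ?_
      (left_mem_segment _ _ _) (right_mem_segment _ _ _) (hU K hKU hK p hpU))
  rw [Set.disjoint_left]
  rintro z ⟨s, t, hs, ht, hst, rfl⟩ hzK
  obtain rfl : s = 1 - t := by linarith
  rcases ht.eq_or_lt with rfl | ht
  · exact hpU (hKU (by simpa using hzK))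
  obtain ⟨i, hi, hz⟩ := mem_iUnion₂.1 hzK
  have hzi := (hadj i (Finset.mem_range.1 hi)).le_abs_sub hδ hz a b
  obtain ⟨⟨h1, h2⟩, h3, h4⟩ := hp
  simp only [gridPoint] at h1 h2 h3 h4
  push_cast at h1 h2
  have key : ∀ x c : ℝ, δ * (c - 1) ≤ x → x ≤ δ * c →
      ¬ δ / 2 ≤ |(1 - t) * x + t * (δ * (c - 1 / 2)) - δ * (c - 1 / 2)| := by
    intro x c hx hx' h
    have h5 : (1 - t) * x + t * (δ * (c - 1 / 2)) - δ * (c - 1 / 2) =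
      (1 - t) * (x - δ * (c - 1 / 2)) := by ring
    have h6 : |x - δ * (c - 1 / 2)| ≤ δ / 2 := abs_le.2 ⟨by linarith, by linarith⟩
    rw [h5, abs_mul, abs_of_nonneg hs] at h
    nlinarith
  rcases hzi with h | h
  · exact key _ _ h1 h3 h
  · exact key _ _ h2 h4 h

/-- `y` is a lift through `f` of the first `n` steps of the grid walk `v`. -/
structure IsGridLift (f : ℝ × ℝ → ℝ × ℝ) (B U : Set (ℝ × ℝ)) (δ : ℝ) (n : ℕ) (y : ℕ → ℝ × ℝ)
    (v : ℕ → ℤ × ℤ) : Prop where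
  map_eq : ∀ i ≤ n, f (y i) = gridPoint δ (v i)
  adj : ∀ i < n, GridAdj (v i) (v (i + 1))
  sameSheet : ∀ i < n, SameSheet f B U (y i) (y (i + 1))

namespace IsGridLift

variable {f : ℝ × ℝ → ℝ × ℝ} {B U : Set (ℝ × ℝ)} {δ : ℝ} {n : ℕ} {y : ℕ → ℝ × ℝ} {v : ℕ → ℤ × ℤ}

lemma segment_subset (h : IsGridLift f B U δ n y v) {i : ℕ} (hi : i < n) :
    segment ℝ (gridPoint δ (v i)) (gridPoint δ (v (i + 1))) ⊆ U := by
  rw [← h.map_eq i hi.le, ← h.map_eq (i + 1) hi]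
  exact (h.sameSheet i hi).segment_subset

lemma shift (h : IsGridLift f B U δ n y v) {i m : ℕ} (him : i + m ≤ n) :
    IsGridLift f B U δ m (fun k ↦ y (i + k)) (fun k ↦ v (i + k)) :=
  ⟨fun k hk ↦ h.map_eq _ (by omega), fun k hk ↦ h.adj _ (by omega),
    fun k hk ↦ h.sameSheet _ (by omega)⟩

/-- A walk with a repeated vertex closes up if shorter walks do. -/
lemma closed_of_repeat
    (ih : ∀ m < n, ∀ y v, IsGridLift f B U δ m y v → v m = v 0 → y m = y 0)
    (h : IsGridLift f B U δ n y v) (hn : v n = v 0) {i j : ℕ} (hij : i < j) (hjn : j ≤ n)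
    (hne : ¬(i = 0 ∧ j = n)) (hv : v i = v j) : y n = y 0 := by
  have hy : y i = y j := by
    have := ih (j - i) (by omega) _ _ (h.shift (i := i) (m := j - i) (by omega))
      (by simp [Nat.add_sub_cancel' hij.le, hv])
    simpa [Nat.add_sub_cancel' hij.le] using this.symm
  let w : ℕ → ℕ := fun k ↦ if k ≤ i then k else k + (j - i)
  have hend : v (w (n - (j - i))) = v n ∧ y (w (n - (j - i))) = y n := by
    by_cases hjn' : j = n
    · have : w (n - (j - i)) = i := by simp only [w]; split_ifs <;> omega
      rw [this, hv, hy, hjn']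
      exact ⟨rfl, rfl⟩
    · have : w (n - (j - i)) = n := by simp only [w]; split_ifs <;> omega
      rw [this]
      exact ⟨rfl, rfl⟩
  have hstep : ∀ k < n - (j - i), ∃ l < n, v (w k) = v l ∧ y (w k) = y l ∧ w (k + 1) = l + 1 := by
    intro k hk
    rcases lt_trichotomy k i with hki | rfl | hki
    · exact ⟨k, by omega, by simp [w, hki.le], by simp [w, hki.le], by
        simp only [w]; split_ifs <;> omega⟩
    · exact ⟨j, by omega, by simp [w, hv], by simp [w, hy], by simp only [w]; split_ifs <;> omega⟩
    · refine ⟨k + (j - i), by omega, ?_, ?_, ?_⟩ <;> simp only [w] <;> split_ifs <;>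
        first | rfl | omega
  have := ih (n - (j - i)) (by omega) (fun k ↦ y (w k)) (fun k ↦ v (w k)) ⟨?_, ?_, ?_⟩ ?_
  · exact hend.2.symm.trans (this.trans (by simp [w]))
  · intro k hk
    exact h.map_eq _ (by simp only [w]; split_ifs <;> omega)
  · intro k hk
    obtain ⟨l, hl, h1, h2, h3⟩ := hstep k hk
    rw [h1, h3]
    exact h.adj l hl
  · intro k hk
    obtain ⟨l, hl, h1, h2, h3⟩ := hstep k hk
    rw [h2, h3]
    exact h.sameSheet l hl
  · exact hend.1.trans (hn.trans (by simp [w]))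

/-- A simple closed walk whose uppermost rightmost vertex is interior closes up if the walk
obtained by pushing that vertex across a grid square does. -/
lemma closed_of_top (hδ : 0 < δ) (hL : HasConvexLifts f B U)
    (hU : ∀ K ⊆ U, IsCompact K → ∀ p ∉ U, HasLogSub K p)
    (h : IsGridLift f B U δ n y v) (hn : v n = v 0) (hn3 : 3 ≤ n)
    (hsimple : ∀ i j, i < j → j ≤ n → v i = v j → i = 0 ∧ j = n)
    {k : ℕ} (hk0 : 0 < k) (hkn : k < n)
    (hmax : ∀ i ≤ n, (v i).2 < (v k).2 ∨ ((v i).2 = (v k).2 ∧ (v i).1 ≤ (v k).1))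
    (ih : ∀ y', f y' = gridPoint δ ((v k).1 - 1, (v k).2 - 1) →
      IsGridLift f B U δ n (Function.update y k y')
        (Function.update v k ((v k).1 - 1, (v k).2 - 1)) →
      Function.update y k y' n = Function.update y k y' 0) : y n = y 0 := by
  obtain ⟨m, rfl⟩ : ∃ m, k = m + 1 := ⟨k - 1, by omega⟩
  obtain ⟨a, b, hab⟩ : ∃ a b, v (m + 1) = (a, b) := ⟨_, _, rfl⟩
  rw [hab] at hmax ih
  simp only at hmax ih
  have hprev : v m = (a - 1, b) ∨ v m = (a, b - 1) := by
    have h1 := h.adj m (by omega)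
    have h2 := hmax m (by omega)
    simp only [hab, GridAdj] at h1
    simp only [Prod.ext_iff]
    omega
  have hnext : v (m + 2) = (a - 1, b) ∨ v (m + 2) = (a, b - 1) := by
    have h1 : GridAdj (v (m + 1)) (v (m + 2)) := h.adj (m + 1) (by omega)
    have h2 := hmax (m + 2) (by omega)
    simp only [hab, GridAdj] at h1
    simp only [Prod.ext_iff]
    omega
  have hne : v m ≠ v (m + 2) := fun h ↦ by
    have := hsimple _ _ (by omega) (by omega) h
    omega
  obtain ⟨e, he, hev⟩ : ∃ e < n, (v e = (a - 1, b) ∧ v (e + 1) = (a, b)) ∨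
      (v e = (a, b) ∧ v (e + 1) = (a - 1, b)) := by
    rcases hprev with h1 | h1
    · exact ⟨m, by omega, Or.inl ⟨h1, hab⟩⟩
    · rcases hnext with h2 | h2
      · exact ⟨m + 1, hkn, Or.inr ⟨hab, h2⟩⟩
      · exact absurd (h1.trans h2.symm) hne
  have hinj : ∀ i j, i ≤ n → j ≤ n → v i = v j → i = j ∨ (i = 0 ∧ j = n) ∨ (j = 0 ∧ i = n) := by
    intro i j hi hj hij
    rcases lt_trichotomy i j with h1 | h1 | h1
    · exact Or.inr (Or.inl (hsimple i j h1 hj hij))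
    · exact Or.inl h1
    · exact Or.inr (Or.inr (hsimple j i h1 hi hij.symm))
  have hQ : Icc (gridPoint δ (a - 1, b - 1)) (gridPoint δ (a, b)) ⊆ U := by
    refine gridSquare_subset hδ hU hn h.adj (fun i hi ↦ h.segment_subset hi) he hev
      (fun i hi ↦ by have := hmax i hi.le; omega) fun i hi hi' ↦ ?_
    have hcase : (v i = v e ∧ v (i + 1) = v (e + 1)) ∨ (v i = v (e + 1) ∧ v (i + 1) = v e) := by
      rcases hev with ⟨h1, h2⟩ | ⟨h1, h2⟩ <;> rw [h1, h2] <;> tauto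
    rcases hcase with ⟨h1, -⟩ | ⟨h1, h2⟩
    · have := hinj _ _ hi.le he.le h1
      omega
    · have := hinj _ _ hi.le he h1
      have := hinj _ _ hi he.le h2
      omega
  have hQc : Convex ℝ (Icc (gridPoint δ (a - 1, b - 1)) (gridPoint δ (a, b))) := convex_Icc _ _
  have hmem : ∀ w : ℤ × ℤ, a - 1 ≤ w.1 → w.1 ≤ a → b - 1 ≤ w.2 → w.2 ≤ b →
      gridPoint δ w ∈ Icc (gridPoint δ (a - 1, b - 1)) (gridPoint δ (a, b)) := by
    intro w h1 h2 h3 h4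
    refine ⟨⟨?_, ?_⟩, ⟨?_, ?_⟩⟩ <;> simp only [gridPoint] <;>
      exact mul_le_mul_of_nonneg_left (by exact_mod_cast ‹_›) hδ.le
  have hpQ : f (y m) ∈ Icc (gridPoint δ (a - 1, b - 1)) (gridPoint δ (a, b)) := by
    rw [h.map_eq m (by omega)]
    apply hmem <;> rcases hprev with h | h <;> rw [h] <;> simp
  have hnQ : f (y (m + 2)) ∈ Icc (gridPoint δ (a - 1, b - 1)) (gridPoint δ (a, b)) := by
    rw [h.map_eq (m + 2) (by omega)]
    apply hmem <;> rcases hnext with h | h <;> rw [h] <;> simp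
  have hkQ : f (y (m + 1)) ∈ Icc (gridPoint δ (a - 1, b - 1)) (gridPoint δ (a, b)) := by
    rw [h.map_eq (m + 1) (by omega), hab]
    apply hmem <;> simp
  have hoQ := hmem (a - 1, b - 1) (by simp) (by simp) (by simp) (by simp)
  obtain ⟨y', hfy', hy'⟩ := SameSheet.exists_of_convex hL (h.sameSheet m (by omega)).mem_right hQc
    hQ hkQ hoQ
  have hfQ : f y' ∈ Icc (gridPoint δ (a - 1, b - 1)) (gridPoint δ (a, b)) := by rwa [hfy']
  have hy1 := (h.sameSheet m (by omega)).trans_of_convex hL hy' hQc hQ hpQ hkQ hfQ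
  have hy2 := hy'.symm.trans_of_convex hL (h.sameSheet (m + 1) hkn) hQc hQ hfQ hkQ hnQ
  have hres := ih y' hfy' ⟨?_, ?_, ?_⟩
  · rwa [Function.update_of_ne hkn.ne', Function.update_of_ne hk0.ne] at hres
  · intro i hi
    by_cases hik : i = m + 1
    · subst hik; simpa using hfy'
    · simpa [hik] using h.map_eq i hi
  · intro i hi
    rcases eq_or_ne i m with rfl | him
    · rw [Function.update_of_ne (by omega), Function.update_self]
      rcases hprev with h | h <;> rw [h] <;> simp [GridAdj]
    rcases eq_or_ne i (m + 1) with rfl | him'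
    · rw [Function.update_self, Function.update_of_ne (by omega)]
      rcases hnext with h | h <;> rw [h] <;> simp [GridAdj]
    · rw [Function.update_of_ne him', Function.update_of_ne (by omega)]
      exact h.adj i hi
  · intro i hi
    rcases eq_or_ne i m with rfl | him
    · rwa [Function.update_of_ne (by omega), Function.update_self]
    rcases eq_or_ne i (m + 1) with rfl | him'
    · rwa [Function.update_self, Function.update_of_ne (by omega)]
    · rw [Function.update_of_ne him', Function.update_of_ne (by omega)]
      exact h.sameSheet i hi

/-- Lifts of closed grid walks are closed. -/
theorem closed (hδ : 0 < δ) (hL : HasConvexLifts f B U) (hUb : Bornology.IsBounded U)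
    (hU : ∀ K ⊆ U, IsCompact K → ∀ p ∉ U, HasLogSub K p)
    (h : IsGridLift f B U δ n y v) (hn : v n = v 0) : y n = y 0 := by
  obtain ⟨R, hR⟩ := hUb.exists_norm_le
  obtain ⟨M, hM⟩ := exists_nat_ge (R / δ)
  have hlow : ∀ w : ℤ × ℤ, gridPoint δ w ∈ U → 0 ≤ w.1 + w.2 + 2 * M := by
    intro w hw
    have key : ∀ m : ℤ, |δ * m| ≤ R → 0 ≤ m + M := by
      intro m hm
      have h1 := (abs_le.1 hm).1
      have h2 := (div_le_iff₀ hδ).1 hM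
      have h3 : δ * (m + M) ≥ 0 := by linarith
      have h4 : (0 : ℝ) ≤ m + M := nonneg_of_mul_nonneg_right h3 hδ
      exact_mod_cast h4
    have h1 := key _ ((norm_fst_le _).trans (hR _ hw))
    have h2 := key _ ((norm_snd_le _).trans (hR _ hw))
    omega
  let wt : ℤ × ℤ → ℕ := fun w ↦ (w.1 + w.2 + 2 * M).toNat
  have hwt : ∀ (v : ℕ → ℤ × ℤ) (n k : ℕ) (y' : ℝ × ℝ), k < n → f y' ∈ U →
      f y' = gridPoint δ ((v k).1 - 1, (v k).2 - 1) →
      ∑ i ∈ Finset.range n, wt (Function.update v k ((v k).1 - 1, (v k).2 - 1) i) <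
        ∑ i ∈ Finset.range n, wt (v i) := by
    intro v n k y' hk hy' hf
    have hlt : wt ((v k).1 - 1, (v k).2 - 1) < wt (v k) := by
      have := hlow _ (hf ▸ hy')
      simp only [wt]
      omega
    refine Finset.sum_lt_sum (fun i _ ↦ ?_) ⟨k, Finset.mem_range.2 hk, by simpa using hlt⟩
    rcases eq_or_ne i k with rfl | hik
    · simpa using hlt.le
    · simp [hik]
  induction n using Nat.strong_induction_on generalizing y v with
  | _ n ihn =>
  obtain ⟨S, hS⟩ : ∃ S, ∑ i ∈ Finset.range n, wt (v i) = S := ⟨_, rfl⟩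
  induction S using Nat.strong_induction_on generalizing y v with
  | _ S ihS =>
  have hmemU : ∀ {y v}, IsGridLift f B U δ n y v → ∀ i < n, f (y i) ∈ U := fun h i hi ↦
    (h.sameSheet i hi).segment_subset (left_mem_segment _ _ _)
  have hmoved : ∀ {y v}, IsGridLift f B U δ n y v → v n = v 0 →
      ∑ i ∈ Finset.range n, wt (v i) = S → ∀ k, 0 < k → k < n →
      ∀ y', f y' = gridPoint δ ((v k).1 - 1, (v k).2 - 1) →
      IsGridLift f B U δ n (Function.update y k y')
        (Function.update v k ((v k).1 - 1, (v k).2 - 1)) →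
      Function.update y k y' n = Function.update y k y' 0 := by
    intro y v h hn hS k hk0 hkn y' hf h'
    have hy'U : f y' ∈ U := by simpa using hmemU h' k hkn
    refine ihS _ (hS ▸ hwt v n k y' hkn hy'U hf) h' ?_ rfl
    rwa [Function.update_of_ne hkn.ne', Function.update_of_ne hk0.ne]
  by_cases hrep : ∃ i j, i < j ∧ j ≤ n ∧ v i = v j ∧ ¬(i = 0 ∧ j = n)
  · obtain ⟨i, j, hij, hjn, hv, hne⟩ := hrep
    exact closed_of_repeat (fun m hm y v ↦ ihn m hm) h hn hij hjn hne hv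
  have hsimple : ∀ i j, i < j → j ≤ n → v i = v j → i = 0 ∧ j = n := fun i j h1 h2 h3 ↦ by
    by_contra h4
    exact hrep ⟨i, j, h1, h2, h3, h4⟩
  rcases Nat.eq_zero_or_pos n with rfl | hn0
  · rfl
  have hn1 : n ≠ 1 := by
    rintro rfl
    have := h.adj 0 hn0
    rw [zero_add, hn] at this
    simp [GridAdj] at this
  have hy_unique : ∀ {z}, SameSheet f B U (y 1) z → f z = gridPoint δ (v 0) → z = y 0 := by
    intro z hz hfz
    exact hz.unique hL (h.sameSheet 0 hn0).symm (hfz.trans (h.map_eq 0 (by omega)).symm)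
  by_cases hn2 : n = 2
  · subst hn2
    exact hy_unique (h.sameSheet 1 (by omega)) (hn ▸ h.map_eq 2 le_rfl)
  obtain ⟨k, hk, hkmax⟩ := (Finset.range n).exists_max_image
    (fun i ↦ toLex ((v i).2, (v i).1)) ⟨0, Finset.mem_range.2 hn0⟩
  have hkn := Finset.mem_range.1 hk
  have hmax : ∀ i ≤ n, (v i).2 < (v k).2 ∨ ((v i).2 = (v k).2 ∧ (v i).1 ≤ (v k).1) := by
    intro i hi
    rcases hi.eq_or_lt with rfl | hi
    · rw [hn]
      simpa [Prod.Lex.toLex_le_toLex] using hkmax 0 (Finset.mem_range.2 hn0)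
    · simpa [Prod.Lex.toLex_le_toLex] using hkmax i (Finset.mem_range.2 hi)
  rcases Nat.eq_zero_or_pos k with rfl | hk0
  swap
  · exact closed_of_top hδ hL hU h hn (by omega) hsimple hk0 hkn hmax (hmoved h hn hS k hk0 hkn)
  -- The extremal vertex is the base point: move the base point along the first edge.
  have hfn : f (y n) = gridPoint δ (v 0) := hn ▸ h.map_eq n le_rfl
  obtain ⟨y₁, hf₁, hy₁⟩ := SameSheet.exists_of_convex hL
    (B := B) (U := U) (x := y n) (b := gridPoint δ (v 1))
    (by
      have := (h.sameSheet (n - 1) (by omega)).mem_right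
      rwa [Nat.sub_add_cancel hn0] at this)
    (convex_segment (gridPoint δ (v 0)) (gridPoint δ (v 1))) (h.segment_subset hn0)
    (hfn ▸ left_mem_segment _ _ _) (right_mem_segment _ _ _)
  let y' : ℕ → ℝ × ℝ := fun i ↦ if i < n then y (i + 1) else y₁
  let v' : ℕ → ℤ × ℤ := fun i ↦ if i < n then v (i + 1) else v 1
  have hy'l : ∀ i < n, y' i = y (i + 1) := fun i hi ↦ if_pos hi
  have hv'l : ∀ i < n, v' i = v (i + 1) := fun i hi ↦ if_pos hi
  have hy'n : y' n = y₁ := if_neg (lt_irrefl n)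
  have hv'n : v' n = v 1 := if_neg (lt_irrefl n)
  have h' : IsGridLift f B U δ n y' v' := by
    refine ⟨fun i hi ↦ ?_, fun i hi ↦ ?_, fun i hi ↦ ?_⟩
    · rcases hi.eq_or_lt with rfl | hi
      · rw [hy'n, hv'n, hf₁]
      · rw [hy'l i hi, hv'l i hi, h.map_eq _ hi]
    · rw [hv'l i hi]
      rcases Nat.eq_or_lt_of_le (Nat.succ_le_of_lt hi) with hi' | hi'
      · rw [Nat.succ_eq_add_one] at hi'
        rw [hi', hv'n, hn]
        exact h.adj 0 hn0
      · rw [hv'l _ hi']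
        exact h.adj _ hi'
    · rw [hy'l i hi]
      rcases Nat.eq_or_lt_of_le (Nat.succ_le_of_lt hi) with hi' | hi'
      · rw [Nat.succ_eq_add_one] at hi'
        rwa [hi', hy'n]
      · rw [hy'l _ hi']
        exact h.sameSheet _ hi'
  have hn' : v' n = v' 0 := by rw [hv'n, hv'l 0 hn0]
  have hS' : ∑ i ∈ Finset.range n, wt (v' i) = S := by
    rw [Finset.sum_congr rfl fun i hi ↦ by rw [hv'l i (Finset.mem_range.1 hi)], ← hS]
    have h1 := Finset.sum_range_succ (fun i ↦ wt (v i)) n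
    have h2 := Finset.sum_range_succ' (fun i ↦ wt (v i)) n
    rw [hn] at h1
    omega
  have hv'k : v' (n - 1) = v 0 := by
    rw [hv'l _ (by omega), Nat.sub_add_cancel hn0, hn]
  have hres := closed_of_top hδ hL hU h' hn' (by omega) (fun i j hij hjn hv ↦ ?_)
    (k := n - 1) (by omega) (by omega) (fun i hi ↦ ?_)
    (hmoved h' hn' hS' _ (by omega) (by omega))
  · rw [hy'n, hy'l 0 hn0] at hres
    exact hy_unique (hres ▸ hy₁.symm) hfn
  · rw [hv'l i (by omega)] at hv
    rcases hjn.eq_or_lt with rfl | hjn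
    · rw [hv'n] at hv
      by_contra hne
      have := hsimple 1 (i + 1) (by omega) (by omega) hv.symm
      omega
    · rw [hv'l j hjn] at hv
      have := hsimple (i + 1) (j + 1) (by omega) (by omega) hv
      omega
  · rw [hv'k]
    rcases hi.eq_or_lt with rfl | hi
    · rw [hv'n]
      exact hmax 1 (by omega)
    · rw [hv'l i hi]
      exact hmax _ hi

end IsGridLift

lemma SameSheet.refl_left {f : ℝ × ℝ → ℝ × ℝ} {B U : Set (ℝ × ℝ)} {x y : ℝ × ℝ}
    (h : SameSheet f B U x y) : SameSheet f B U x x := by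
  obtain ⟨C, hC, hCc, hx, hy, s, h1, h2, h3, h4, h5⟩ := h
  exact ⟨C, hC, hCc, hx, hx, s, h1, h2, h3, h4, h4⟩

/-- Two points on the same sheet which lie over neighbouring grid points. -/
def GridStep (f : ℝ × ℝ → ℝ × ℝ) (B U : Set (ℝ × ℝ)) (δ : ℝ) (x y : ℝ × ℝ) : Prop :=
  SameSheet f B U x y ∧ ∃ v w, f x = gridPoint δ v ∧ f y = gridPoint δ w ∧ GridAdj v w

lemma gridPoint_injective {δ : ℝ} (hδ : 0 < δ) : Function.Injective (gridPoint δ) := by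
  intro v w h
  obtain ⟨h1, h2⟩ := Prod.ext_iff.1 h
  have h1' := mul_left_cancel₀ hδ.ne' h1
  have h2' := mul_left_cancel₀ hδ.ne' h2
  exact Prod.ext (by exact_mod_cast h1') (by exact_mod_cast h2')

namespace GridStep

variable {f : ℝ × ℝ → ℝ × ℝ} {B U : Set (ℝ × ℝ)} {δ : ℝ} {x y : ℝ × ℝ}

lemma exists_isGridLift (hδ : 0 < δ) (h : Relation.ReflTransGen (GridStep f B U δ) x y)
    {u : ℤ × ℤ} (hx : f x = gridPoint δ u) :
    ∃ n w v, IsGridLift f B U δ n w v ∧ w 0 = x ∧ w n = y := by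
  induction h with
  | refl => exact ⟨0, fun _ ↦ x, fun _ ↦ u, ⟨fun _ _ ↦ hx, by simp, by simp⟩, rfl, rfl⟩
  | @tail b c _ hbc ih =>
    obtain ⟨n, w, v, hw, h0, hn⟩ := ih
    obtain ⟨hs, p, q, hp, hq, hpq⟩ := hbc
    have hvn : v n = p := gridPoint_injective hδ (by rw [← hw.map_eq n le_rfl, hn, hp])
    refine ⟨n + 1, fun i ↦ if i ≤ n then w i else c, fun i ↦ if i ≤ n then v i else q,
      ⟨fun i hi ↦ ?_, fun i hi ↦ ?_, fun i hi ↦ ?_⟩, by simp [h0], by simp⟩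
    · by_cases h : i ≤ n
      · simpa [h] using hw.map_eq i h
      · simpa [h] using hq
    · rcases (Nat.lt_succ_iff.1 hi).eq_or_lt with rfl | h
      · simpa [hvn] using hpq
      · simpa [h.le, Nat.succ_le_of_lt h] using hw.adj i h
    · rcases (Nat.lt_succ_iff.1 hi).eq_or_lt with rfl | h
      · simpa [hn] using hs
      · simpa [h.le, Nat.succ_le_of_lt h] using hw.sameSheet i h

lemma eq_of_reflTransGen (hδ : 0 < δ) (hL : HasConvexLifts f B U) (hUb : Bornology.IsBounded U)
    (hU : ∀ K ⊆ U, IsCompact K → ∀ p ∉ U, HasLogSub K p)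
    (h : Relation.ReflTransGen (GridStep f B U δ) x y) {u : ℤ × ℤ} (hx : f x = gridPoint δ u)
    (hy : f y = gridPoint δ u) : y = x := by
  obtain ⟨n, w, v, hw, rfl, rfl⟩ := exists_isGridLift hδ h hx
  refine hw.closed hδ hL hUb hU (gridPoint_injective hδ ?_)
  rw [← hw.map_eq n le_rfl, ← hw.map_eq 0 (Nat.zero_le n), hx, hy]

lemma reflTransGen_of_eq_or_adj (hL : HasConvexLifts f B U) (h : SameSheet f B U x y)
    {v w : ℤ × ℤ} (hx : f x = gridPoint δ v) (hy : f y = gridPoint δ w)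
    (hvw : v = w ∨ GridAdj v w) : Relation.ReflTransGen (GridStep f B U δ) x y := by
  rcases hvw with rfl | hvw
  · rw [h.unique hL h.refl_left (hy.trans hx.symm)]
  · exact .single ⟨h, v, w, hx, hy, hvw⟩

/-- Points on the same sheet over a square, above grid points which differ by at most one in
each coordinate, are joined by grid steps. -/
lemma reflTransGen_of_ball (hL : HasConvexLifts f B U) (h : SameSheet f B U x y)
    {v w : ℤ × ℤ} (hx : f x = gridPoint δ v) (hy : f y = gridPoint δ w)
    {c : ℝ × ℝ} {ε : ℝ} (hU : Metric.ball c ε ⊆ U) (hxc : f x ∈ Metric.ball c ε)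
    (hyc : f y ∈ Metric.ball c ε) (h1 : |v.1 - w.1| ≤ 1) (h2 : |v.2 - w.2| ≤ 1) :
    Relation.ReflTransGen (GridStep f B U δ) x y := by
  have hm : gridPoint δ (w.1, v.2) ∈ Metric.ball c ε := by
    rw [hx] at hxc
    rw [hy] at hyc
    simp only [Metric.mem_ball, Prod.dist_eq, max_lt_iff] at hxc hyc ⊢
    exact ⟨hyc.1, hxc.2⟩
  obtain ⟨m, hfm, hxm⟩ := SameSheet.exists_of_convex hL h.mem_left (convex_ball c ε) hU hxc hm
  have hmy := hxm.symm.trans_of_convex hL h (convex_ball c ε) hU (hfm ▸ hm) hxc hyc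
  rw [abs_le] at h1 h2
  refine (reflTransGen_of_eq_or_adj hL hxm hx hfm ?_).trans
    (reflTransGen_of_eq_or_adj hL hmy hfm hy ?_) <;>
  · simp only [GridAdj, Prod.ext_iff, true_and, and_true]
    omega

end GridStep

/-- The grid point to the lower left of a point of the plane. -/
noncomputable def gridFloor (δ : ℝ) (p : ℝ × ℝ) : ℤ × ℤ := (⌊p.1 / δ⌋, ⌊p.2 / δ⌋)

lemma dist_gridFloor_le {δ : ℝ} (hδ : 0 < δ) (p : ℝ × ℝ) :
    dist (gridPoint δ (gridFloor δ p)) p ≤ δ := by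
  have key : ∀ x : ℝ, dist (δ * (⌊x / δ⌋ : ℝ)) x ≤ δ := by
    intro x
    have h1 := (le_div_iff₀ hδ).1 (Int.floor_le (x / δ))
    have h2 := (div_lt_iff₀ hδ).1 (Int.lt_floor_add_one (x / δ))
    rw [Real.dist_eq, abs_le]
    constructor <;> linarith
  rw [Prod.dist_eq]
  exact max_le (key _) (key _)

lemma abs_floor_sub_floor_le {δ : ℝ} (hδ : 0 < δ) {x y : ℝ} (h : dist x y < δ) :
    |⌊x / δ⌋ - ⌊y / δ⌋| ≤ 1 := by
  have key : ∀ x y : ℝ, x - y < δ → ⌊x / δ⌋ - ⌊y / δ⌋ ≤ 1 := by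
    intro x y h
    have h1 := Int.floor_le (x / δ)
    have h2 := Int.lt_floor_add_one (y / δ)
    have h3 : x / δ - y / δ < 1 := by
      rw [← sub_div]
      exact (div_lt_one hδ).2 h
    have h4 : ((⌊x / δ⌋ : ℤ) : ℝ) < ⌊y / δ⌋ + 2 := by linarith
    have h5 : ⌊x / δ⌋ < ⌊y / δ⌋ + 2 := by exact_mod_cast h4
    omega
  rw [Real.dist_eq, abs_lt] at h
  rw [abs_le]
  have := key x y (by linarith)
  have := key y x (by linarith)
  omega

/-- A map with unique lifting over a bounded open set without holes is injective on each connected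
open set on which it is defined. -/
theorem HasConvexLifts.injOn {f : ℝ × ℝ → ℝ × ℝ} {B U : Set (ℝ × ℝ)} (hL : HasConvexLifts f B U)
    (hB : IsOpen B) (hBc : IsConnected B) (hf : ContinuousOn f B) (hm : MapsTo f B U)
    (hUo : IsOpen U) (hUb : Bornology.IsBounded U)
    (hU : ∀ K ⊆ U, IsCompact K → ∀ p ∉ U, HasLogSub K p) : InjOn f B := by
  intro x₁ hx₁ x₂ hx₂ hx
  obtain ⟨γ, hγ⟩ := (hB.isConnected_iff_isPathConnected.1 hBc).joinedIn x₁ hx₁ x₂ hx₂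
  set σ : ℝ → ℝ × ℝ := fun t ↦ γ.extend t with hσ
  have hσc : Continuous σ := γ.continuous_extend
  have hσB : ∀ t, σ t ∈ B := fun t ↦ by
    obtain ⟨s, hs⟩ : σ t ∈ range γ := γ.extend_range ▸ mem_range_self t
    exact hs ▸ hγ s
  have hg : Continuous (fun t ↦ f (σ t)) := hf.comp_continuous hσc hσB
  obtain ⟨ε, hε, hεU⟩ := (isCompact_Icc.image hg).exists_thickening_subset_open hUo
    (by rintro _ ⟨t, -, rfl⟩; exact hm (hσB t) : (fun t ↦ f (σ t)) '' Icc 0 1 ⊆ U)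
  have hball : ∀ t ∈ Icc (0 : ℝ) 1, Metric.ball (f (σ t)) ε ⊆ U := fun t ht ↦
    (Metric.ball_subset_thickening (mem_image_of_mem _ ht) ε).trans hεU
  have hδ : 0 < ε / 4 := by positivity
  set δ := ε / 4 with hδε
  obtain ⟨η, hη, hunif⟩ := Metric.uniformContinuousOn_iff.1
    (isCompact_Icc.uniformContinuousOn_of_continuous hg.continuousOn : UniformContinuousOn
      (fun t ↦ f (σ t)) (Icc (0 : ℝ) 1)) δ hδ
  obtain ⟨N, hN⟩ := exists_nat_one_div_lt hη
  let t : ℕ → ℝ := fun i ↦ i / (N + 1)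
  have hNpos : (0 : ℝ) < N + 1 := by positivity
  have ht0 : t 0 = 0 := by simp [t]
  have htN : t (N + 1) = 1 := by simp only [t]; push_cast; exact div_self hNpos.ne'
  have hstep : ∀ i, t (i + 1) = t i + 1 / (N + 1) := fun i ↦ by
    simp only [t]; push_cast; exact add_div _ _ _
  have htmem : ∀ i ≤ N + 1, t i ∈ Icc (0 : ℝ) 1 := fun i hi ↦ by
    refine ⟨by positivity, (div_le_one hNpos).2 ?_⟩
    exact_mod_cast hi
  have hlift : ∀ i ≤ N + 1, ∃ y, f y = gridPoint δ (gridFloor δ (f (σ (t i)))) ∧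
      SameSheet f B U (σ (t i)) y := fun i hi ↦
    SameSheet.exists_of_convex hL (hσB _) (convex_ball _ ε) (hball _ (htmem i hi))
      (Metric.mem_ball_self hε) (Metric.mem_ball.2 ((dist_gridFloor_le hδ _).trans_lt (by linarith)))
  choose! y hfy hy using hlift
  have hchain : ∀ i ≤ N + 1, Relation.ReflTransGen (GridStep f B U δ) (y 0) (y i) := by
    intro i
    induction i with
    | zero => exact fun _ ↦ .refl
    | succ i ih =>
      intro hi
      have hi' : i ≤ N + 1 := by omega
      have hpos : (0 : ℝ) < 1 / (N + 1) := by positivity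
      have hlt : t i < t (i + 1) := by rw [hstep]; linarith
      have hnear : ∀ s ∈ Icc (t i) (t (i + 1)), dist (f (σ s)) (f (σ (t i))) < δ := by
        intro s hs
        refine hunif s ⟨(htmem i hi').1.trans hs.1, hs.2.trans (htmem _ hi).2⟩ _ (htmem i hi') ?_
        rw [Real.dist_eq, abs_of_nonneg (by linarith [hs.1])]
        have := hs.2
        rw [hstep] at this
        linarith
      have hd := hnear _ ⟨hlt.le, le_rfl⟩
      have hbU := hball _ (htmem i hi')
      have hyi : f (y i) ∈ Metric.ball (f (σ (t i))) ε := by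
        rw [hfy i hi', Metric.mem_ball]
        exact (dist_gridFloor_le hδ _).trans_lt (by linarith)
      have hyi' : f (y (i + 1)) ∈ Metric.ball (f (σ (t i))) ε := by
        rw [hfy _ hi, Metric.mem_ball]
        have := dist_triangle (gridPoint δ (gridFloor δ (f (σ (t (i + 1))))))
          (f (σ (t (i + 1)))) (f (σ (t i)))
        have := dist_gridFloor_le hδ (f (σ (t (i + 1))))
        linarith
      have hpath : SameSheet f B U (σ (t i)) (σ (t (i + 1))) :=
        SameSheet.of_path hL hf (convex_Icc (t i) (t (i + 1))) hσc.continuousOn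
          (fun s _ ↦ hσB s) (convex_ball _ ε) hbU
          (fun s hs ↦ Metric.mem_ball.2 ((hnear s hs).trans (by linarith)))
          ⟨le_rfl, hlt.le⟩ ⟨hlt.le, le_rfl⟩
      have hmid : f (σ (t (i + 1))) ∈ Metric.ball (f (σ (t i))) ε :=
        Metric.mem_ball.2 (hd.trans (by linarith))
      have h1 := (hy i hi').symm.trans_of_convex hL hpath (convex_ball _ ε) hbU hyi
        (Metric.mem_ball_self hε) hmid
      have h2 := h1.trans_of_convex hL (hy _ hi) (convex_ball _ ε) hbU hyi hmid hyi'
      rw [dist_comm, Prod.dist_eq, max_lt_iff] at hd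
      exact (ih hi').trans (GridStep.reflTransGen_of_ball hL h2 (hfy i hi') (hfy _ hi) hbU hyi hyi'
        (abs_floor_sub_floor_le hδ hd.1) (abs_floor_sub_floor_le hδ hd.2))
  have hσ0 : σ (t 0) = x₁ := by rw [ht0]; exact γ.extend_zero
  have hσ1 : σ (t (N + 1)) = x₂ := by rw [htN]; exact γ.extend_one
  have hf0 := hfy 0 (Nat.zero_le _)
  have hf1 := hfy (N + 1) le_rfl
  have hs0 := hy 0 (Nat.zero_le _)
  have hs1 := hy (N + 1) le_rfl
  rw [hσ0] at hf0 hs0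
  rw [hσ1, ← hx] at hf1
  rw [hσ1] at hs1
  have heq := GridStep.eq_of_reflTransGen hδ hL hUb hU (hchain (N + 1) le_rfl) hf0 hf1
  rw [heq] at hs1
  exact hs0.symm.unique hL hs1.symm hx

/-- Lemma B.1: if `X` and `Y` are Jordan curves with interiors `B_X`, `B_Y`, and
`f` is continuous on `closure B_X`, a local homeomorphism on `B_X` with bounded
image, and `f(X) ⊆ Y`, then `f` restricts to a homeomorphism of `B_X` onto `B_Y`. -/
theorem stmt_10 (X Y BX BY : Set (ℝ × ℝ))
    (hX : IsJordanCurve X) (hY : IsJordanCurve Y)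
    (hBX : IsJordanInterior X BX) (hBY : IsJordanInterior Y BY)
    (f : ℝ × ℝ → ℝ × ℝ)
    (hfc : ContinuousOn f (closure BX))
    (hloc : IsLocalHomeomorphOn f BX)
    (hbdd : Bornology.IsBounded (f '' BX))
    (hXY : f '' X ⊆ Y) :
    f '' BX = BY ∧ Set.InjOn f BX ∧
      ∃ g : ℝ × ℝ → ℝ × ℝ, ContinuousOn g BY ∧ Set.MapsTo g BY BX ∧
        (∀ x ∈ BX, g (f x) = x) ∧ ∀ y ∈ BY, f (g y) = y := by
  have himage := hBX.image_eq hX hY hBY hfc hloc hXY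
  have hinj : InjOn f BX := (hBX.hasConvexLifts hX hBY hfc hloc hXY).injOn (hBX.isOpen hX)
    hBX.isConnected (hfc.mono subset_closure) (mapsTo_iff_image_subset.2 himage.subset)
    (hBY.isOpen hY) hBY.1 fun K hK hKc p hp ↦ hBY.hasLogSub hY hKc hK hp
  have hleft : ∀ x ∈ BX, Function.invFunOn f BX (f x) = x := fun x hx ↦ hinj.leftInvOn_invFunOn hx
  refine ⟨himage, hinj, Function.invFunOn f BX, ?_, ?_, hleft, ?_⟩
  · rw [← himage]
    rintro _ ⟨x, hx, rfl⟩
    refine ContinuousAt.continuousWithinAt ?_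
    rw [ContinuousAt, ← hloc.map_nhds_eq hx, Filter.tendsto_map'_iff, hleft x hx]
    refine Filter.Tendsto.congr' ?_ Filter.tendsto_id
    filter_upwards [(hBX.isOpen hX).mem_nhds hx] with z hz using (hleft z hz).symm
  · rw [← himage]
    rintro _ ⟨x, hx, rfl⟩
    rwa [hleft x hx]
  · rw [← himage]
    rintro _ ⟨x, hx, rfl⟩
    rw [hleft x hx]
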